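/- arXiv:1901.01109 — 2 statements merged into one kernel-verified Lean document; each statement's English description precedes it below -/
import Mathlib

section
/- For every natural number $N$, as $x \to 0^+$: $\sum_{n=1}^{\infty} \frac{\sigma(n)}{\sqrt{n}} e^{-n^2 x} = \frac{\pi^2}{9}\Gamma\left(\frac{7}{4}\right) x^{-3/4} - \Gamma\left(\frac{5}{4}\right) x^{-1/4} + \sum_{n=0}^{N} \frac{(-x)^n}{n!} \zeta\left(\frac{1-4n}{2}\right)\zeta\left(\frac{-1-4n}{2}\right) + o(x^N)$. -/
open Complex Real Filter Asymptotics

section MellinExpansion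

open MeasureTheory Set Topology

theorem integrableOn_rpow_mul_exp_neg_mul {σ c : ℝ} (hσ : 0 < σ) (hc : 0 < c) :
    IntegrableOn (fun t : ℝ ↦ t ^ (σ - 1) * Real.exp (-(c * t))) (Ioi 0) := by
  have := integrableOn_rpow_mul_exp_neg_mul_rpow (p := 1) (s := σ - 1) (b := c) (by linarith)
    (by norm_num) hc
  simpa using this

theorem norm_cpow_mul_exp_neg_mul (a r : ℂ) {t : ℝ} (ht : 0 < t) :
    ‖(t : ℂ) ^ (a - 1) * Complex.exp (-(r * t))‖ =
      t ^ (a.re - 1) * Real.exp (-(r.re * t)) := by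
  rw [norm_mul, norm_cpow_eq_rpow_re_of_pos ht, Complex.norm_exp]
  simp

theorem aestronglyMeasurable_cpow_mul_exp (a r : ℂ) :
    AEStronglyMeasurable (fun t : ℝ ↦ (t : ℂ) ^ (a - 1) * Complex.exp (-(r * t)))
      (volume.restrict (Ioi 0)) := by
  refine ContinuousOn.aestronglyMeasurable (fun t ht ↦ ContinuousAt.continuousWithinAt ?_)
    measurableSet_Ioi
  refine ContinuousAt.mul ?_ (by fun_prop)
  exact (continuousAt_cpow_const (Complex.ofReal_mem_slitPlane.2 ht)).comp
    Complex.continuous_ofReal.continuousAt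

theorem differentiableAt_integral_cpow_mul_exp_neg_mul {a r : ℂ} (ha : 0 < a.re) (hr : 0 < r.re) :
    DifferentiableAt ℂ
      (fun r : ℂ ↦ ∫ t : ℝ in Ioi 0, (t : ℂ) ^ (a - 1) * Complex.exp (-(r * t))) r := by
  have hball : ∀ z ∈ Metric.ball r (r.re / 2), r.re / 2 ≤ z.re := by
    intro z hz
    have h1 := (Complex.abs_re_le_norm (z - r)).trans_lt (mem_ball_iff_norm.1 hz)
    rw [Complex.sub_re] at h1
    linarith [(abs_lt.1 h1).1]
  refine (hasDerivAt_integral_of_dominated_loc_of_deriv_le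
    (F' := fun z t ↦ -((t : ℂ) ^ ((a + 1) - 1) * Complex.exp (-(z * t))))
    (bound := fun t ↦ t ^ ((a + 1).re - 1) * Real.exp (-(r.re / 2 * t)))
    (Metric.ball_mem_nhds r (half_pos hr)) ?_ ?_ ?_ ?_ ?_ ?_).2.differentiableAt
  · exact Eventually.of_forall fun z ↦ aestronglyMeasurable_cpow_mul_exp a z
  · refine (integrable_norm_iff (aestronglyMeasurable_cpow_mul_exp a r)).1 ?_
    exact (integrableOn_rpow_mul_exp_neg_mul ha hr).congr_fun
      (fun t ht ↦ (norm_cpow_mul_exp_neg_mul a r ht).symm) measurableSet_Ioi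
  · exact (aestronglyMeasurable_cpow_mul_exp (a + 1) r).neg
  · refine (ae_restrict_iff' measurableSet_Ioi).2 (Eventually.of_forall fun t ht z hz ↦ ?_)
    have ht : 0 < t := ht
    rw [norm_neg, norm_cpow_mul_exp_neg_mul _ _ ht]
    gcongr
    exact hball z hz
  · exact integrableOn_rpow_mul_exp_neg_mul (by simp; linarith) (half_pos hr)
  · refine (ae_restrict_iff' measurableSet_Ioi).2 (Eventually.of_forall fun t ht z _ ↦ ?_)
    have h0 : (t : ℂ) ≠ 0 := Complex.ofReal_ne_zero.2 (ne_of_gt ht)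
    have h1 : HasDerivAt (fun z : ℂ ↦ Complex.exp (-(z * t)))
        (Complex.exp (-(z * t)) * -(1 * t)) z :=
      (((hasDerivAt_id z).mul_const (t : ℂ)).neg).cexp
    refine (h1.const_mul ((t : ℂ) ^ (a - 1))).congr_deriv ?_
    rw [show a + 1 - 1 = (a - 1) + 1 by ring, Complex.cpow_add _ _ h0, Complex.cpow_one]
    ring

theorem integral_cpow_mul_exp_neg_complex_mul {a r : ℂ} (ha : 0 < a.re) (hr : 0 < r.re) :
    ∫ t : ℝ in Ioi 0, (t : ℂ) ^ (a - 1) * Complex.exp (-(r * t)) =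
      r ^ (-a) * Complex.Gamma a := by
  have hopen : IsOpen {r : ℂ | 0 < r.re} := isOpen_lt continuous_const Complex.continuous_re
  have hL : AnalyticOnNhd ℂ
      (fun r : ℂ ↦ ∫ t : ℝ in Ioi 0, (t : ℂ) ^ (a - 1) * Complex.exp (-(r * t)))
      {r : ℂ | 0 < r.re} :=
    DifferentiableOn.analyticOnNhd (fun r hr ↦
      (differentiableAt_integral_cpow_mul_exp_neg_mul ha hr).differentiableWithinAt) hopen
  have hR : AnalyticOnNhd ℂ (fun r : ℂ ↦ r ^ (-a) * Complex.Gamma a) {r : ℂ | 0 < r.re} := by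
    refine DifferentiableOn.analyticOnNhd (fun r hr ↦ ?_) hopen
    refine DifferentiableAt.differentiableWithinAt (DifferentiableAt.mul_const ?_ _)
    exact differentiableAt_id.cpow_const (Or.inl hr)
  refine hL.eqOn_of_preconnected_of_frequently_eq hR
    (convex_halfSpace_re_gt 0).isPreconnected (z₀ := 1) (by simp) ?_ hr
  have htend : Tendsto (fun x : ℝ ↦ (x : ℂ)) (𝓝[>] 1) (𝓝[≠] 1) := by
    refine tendsto_nhdsWithin_iff.2 ⟨?_, ?_⟩
    · exact (Complex.continuous_ofReal.tendsto' 1 1 (by simp)).mono_left nhdsWithin_le_nhds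
    · filter_upwards [self_mem_nhdsWithin] with x hx
      simpa using (ne_of_gt hx : x ≠ 1)
  refine htend.frequently (Eventually.frequently ?_)
  filter_upwards [self_mem_nhdsWithin] with x hx
  have hx0 : 0 < x := zero_lt_one.trans hx
  rw [Complex.integral_cpow_mul_exp_neg_mul_Ioi ha hx0, one_div,
    Complex.inv_cpow _ _ (by rw [Complex.arg_ofReal_of_nonneg hx0.le]; exact pi_pos.ne),
    Complex.cpow_neg]

theorem exp_mul_norm_Gamma_le {a : ℂ} (ha : 0 < a.re) {φ : ℝ} (hφ : |φ| < π / 2) :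
    Real.exp (φ * a.im) * ‖Complex.Gamma a‖ ≤ (1 / Real.cos φ) ^ a.re * Real.Gamma a.re := by
  have hφ' := abs_lt.1 hφ
  have hcos : 0 < Real.cos φ := Real.cos_pos_of_mem_Ioo ⟨by linarith [hφ'.1], hφ'.2⟩
  set r : ℂ := Complex.exp (φ * I) with hr
  have hre : r.re = Real.cos φ := Complex.exp_ofReal_mul_I_re φ
  have h := integral_cpow_mul_exp_neg_complex_mul ha (r := r) (hre ▸ hcos)
  have hpow : r ^ (-a) = Complex.exp (φ * I * -a) := by
    rw [hr, Complex.cpow_def_of_ne_zero (Complex.exp_ne_zero _), Complex.log_exp]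
    · simp; linarith [hφ'.1, pi_pos]
    · simp; linarith [hφ'.2, pi_pos]
  have hn : ‖r ^ (-a)‖ = Real.exp (φ * a.im) := by
    rw [hpow, Complex.norm_exp]; simp
  rw [← hn, ← norm_mul, ← h, ← Real.integral_rpow_mul_exp_neg_mul_Ioi ha hcos]
  refine (norm_integral_le_integral_norm _).trans_eq ?_
  refine setIntegral_congr_fun measurableSet_Ioi fun t ht ↦ ?_
  rw [norm_cpow_mul_exp_neg_mul _ _ ht, hre]

/-- In a vertical strip the Gamma function decays like `exp (-φ |im s|)` for every `φ < π / 2`. -/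
theorem exists_norm_Gamma_le_exp {φ : ℝ} (hφ0 : 0 ≤ φ) (hφ : φ < π / 2) {δ : ℝ} (hδ : 0 < δ)
    (a b : ℝ) : ∃ C : ℝ, 0 ≤ C ∧ ∀ s : ℂ, a ≤ s.re → s.re ≤ b → δ ≤ |s.im| →
      ‖Complex.Gamma s‖ ≤ C * Real.exp (-φ * |s.im|) := by
  have key : ∀ n : ℕ, ∀ a b : ℝ, -(n : ℝ) < a → ∃ C : ℝ, 0 ≤ C ∧ ∀ s : ℂ, a ≤ s.re → s.re ≤ b →
      δ ≤ |s.im| → ‖Complex.Gamma s‖ ≤ C * Real.exp (-φ * |s.im|) := by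
    intro n
    induction n with
    | zero =>
      intro a b ha
      simp only [CharP.cast_eq_zero, neg_zero] at ha
      have hcos : 0 < Real.cos φ := Real.cos_pos_of_mem_Ioo ⟨by linarith [pi_pos], hφ⟩
      have hcont : ContinuousOn (fun x : ℝ ↦ (1 / Real.cos φ) ^ x * Real.Gamma x) (Icc a b) := by
        intro x hx
        refine ContinuousAt.continuousWithinAt (ContinuousAt.mul ?_ ?_)
        · exact Real.continuousAt_const_rpow (by positivity)
        · refine (Real.differentiableAt_Gamma fun m ↦ ?_).continuousAt
          have : (0 : ℝ) ≤ m := m.cast_nonneg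
          linarith [hx.1]
      obtain ⟨C, hC⟩ := isCompact_Icc.exists_bound_of_continuousOn hcont
      refine ⟨max C 0, le_max_right _ _, fun s h1 h2 _ ↦ ?_⟩
      have hs : 0 < s.re := ha.trans_le h1
      have hb : (1 / Real.cos φ) ^ s.re * Real.Gamma s.re ≤ max C 0 :=
        ((Real.le_norm_self _).trans (hC s.re ⟨h1, h2⟩)).trans (le_max_left _ _)
      have hmain : Real.exp (φ * |s.im|) * ‖Complex.Gamma s‖ ≤ max C 0 := by
        rcases abs_cases s.im with ⟨h, -⟩ | ⟨h, -⟩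
        · rw [h]
          exact (exp_mul_norm_Gamma_le hs (by rwa [abs_of_nonneg hφ0])).trans hb
        · rw [h, ← neg_mul_comm]
          refine (exp_mul_norm_Gamma_le hs (by rwa [abs_neg, abs_of_nonneg hφ0])).trans ?_
          rwa [Real.cos_neg]
      rw [neg_mul, Real.exp_neg, ← div_eq_mul_inv, le_div_iff₀ (Real.exp_pos _), mul_comm]
      exact hmain
    | succ n ih =>
      intro a b ha
      push_cast at ha
      obtain ⟨C, hC0, hC⟩ := ih (a + 1) (b + 1) (by linarith)
      refine ⟨C / δ, by positivity, fun s h1 h2 h3 ↦ ?_⟩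
      have hs : δ ≤ ‖s‖ := h3.trans (Complex.abs_im_le_norm s)
      have hs0 : s ≠ 0 := norm_pos_iff.1 (hδ.trans_le hs)
      have hG := hC (s + 1) (by simpa using h1) (by simpa using h2) (by simpa using h3)
      rw [Complex.Gamma_add_one s hs0, norm_mul] at hG
      simp only [Complex.add_im, Complex.one_im, add_zero] at hG
      rw [div_mul_eq_mul_div, le_div_iff₀ hδ, mul_comm]
      exact (mul_le_mul_of_nonneg_right hs (norm_nonneg _)).trans hG
  obtain ⟨n, hn⟩ := exists_nat_gt (-a)
  exact key n a b (by linarith)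

/-- The `n`-th term of a series for `(s - 1) * ζ s - 1` which converges for `0 < re s`. -/
noncomputable def zetaRemainderTerm (n : ℕ) (s : ℂ) : ℂ :=
  (s - 1) * ((n : ℂ) + 1) ^ (-s) - (((n : ℂ) + 1) ^ (1 - s) - ((n : ℂ) + 1 + 1) ^ (1 - s))

theorem norm_zetaRemainderTerm_le (n : ℕ) {s : ℂ} (hs : 0 < s.re) :
    ‖zetaRemainderTerm n s‖ ≤ ‖s‖ * ‖s - 1‖ * ((n : ℝ) + 1) ^ (-s.re - 1) := by
  set m : ℝ := (n : ℝ) + 1 with hm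
  have hm0 : 0 < m := by positivity
  have hpos : ∀ u ∈ Icc m (m + 1), 0 < u := fun u hu ↦ hm0.trans_le hu.1
  have hderiv : ∀ (r : ℂ) (u : ℝ), 0 < u →
      HasDerivAt (fun u : ℝ ↦ (u : ℂ) ^ r) (r * (u : ℂ) ^ (r - 1)) u := by
    intro r u hu
    have := ((hasDerivAt_id (u : ℂ)).cpow_const (c := r)
      (Complex.ofReal_mem_slitPlane.2 hu)).comp_ofReal
    simpa using this
  have hmem : m ∈ Icc m (m + 1) := ⟨le_rfl, by linarith⟩
  have h1 : ∀ u ∈ Icc m (m + 1),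
      ‖(u : ℂ) ^ (-s) - (m : ℂ) ^ (-s)‖ ≤ ‖s‖ * m ^ (-s.re - 1) := by
    intro u hu
    have := (convex_Icc m (m + 1)).norm_image_sub_le_of_norm_hasDerivWithin_le
      (f := fun u : ℝ ↦ (u : ℂ) ^ (-s)) (f' := fun u ↦ -s * (u : ℂ) ^ (-s - 1))
      (C := ‖s‖ * m ^ (-s.re - 1)) (fun x hx ↦ (hderiv (-s) x (hpos x hx)).hasDerivWithinAt)
      (fun x hx ↦ ?_) hmem hu
    · refine this.trans (mul_le_of_le_one_right (by positivity) ?_)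
      rw [Real.norm_eq_abs, abs_le]
      constructor <;> linarith [hu.1, hu.2]
    · rw [norm_mul, norm_neg, norm_cpow_eq_rpow_re_of_pos (hpos x hx)]
      simp only [Complex.sub_re, Complex.neg_re, Complex.one_re]
      gcongr ‖s‖ * ?_
      exact Real.rpow_le_rpow_of_nonpos hm0 hx.1 (by linarith)
  have h2 := (convex_Icc m (m + 1)).norm_image_sub_le_of_norm_hasDerivWithin_le
      (f := fun u : ℝ ↦ (u : ℂ) ^ (1 - s) - (1 - s) * (m : ℂ) ^ (-s) * u)
      (f' := fun u ↦ (1 - s) * (u : ℂ) ^ (-s) - (1 - s) * (m : ℂ) ^ (-s))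
      (C := ‖s - 1‖ * (‖s‖ * m ^ (-s.re - 1)))
      (x := m) (y := m + 1) (fun x hx ↦ ?_) (fun x hx ↦ ?_) hmem ⟨by linarith, le_rfl⟩
  · have h3 : zetaRemainderTerm n s =
        (((m + 1 : ℝ) : ℂ) ^ (1 - s) - (1 - s) * (m : ℂ) ^ (-s) * ((m + 1 : ℝ) : ℂ)) -
          ((m : ℂ) ^ (1 - s) - (1 - s) * (m : ℂ) ^ (-s) * m) := by
      simp only [zetaRemainderTerm, hm]
      push_cast
      ring
    rw [h3]
    refine h2.trans_eq ?_
    simp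
    ring
  · have h4 := (hderiv (1 - s) x (hpos x hx)).sub
      (((hasDerivAt_id x).ofReal_comp).const_mul ((1 - s) * (m : ℂ) ^ (-s)))
    simp only [id, Complex.ofReal_one, mul_one, sub_sub_cancel_left] at h4
    exact h4.hasDerivWithinAt
  · rw [← mul_sub, norm_mul, norm_sub_rev 1 s]
    gcongr
    exact h1 x hx

theorem summable_nat_add_one_rpow {p : ℝ} (hp : p < -1) :
    Summable fun n : ℕ ↦ ((n : ℝ) + 1) ^ p := by
  have := (summable_nat_add_iff 1).2 (Real.summable_nat_rpow.2 hp)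
  simpa using this

theorem summable_zetaRemainderTerm {s : ℂ} (hs : 0 < s.re) :
    Summable fun n ↦ zetaRemainderTerm n s :=
  Summable.of_norm_bounded ((summable_nat_add_one_rpow (p := -s.re - 1) (by linarith)).mul_left _)
    fun n ↦ norm_zetaRemainderTerm_le n hs

theorem differentiableOn_tsum_zetaRemainderTerm :
    DifferentiableOn ℂ (fun s ↦ ∑' n, zetaRemainderTerm n s) {s : ℂ | 0 < s.re} := by
  intro s hs
  have hs : 0 < s.re := hs
  set U : Set ℂ := {z | s.re / 2 < z.re} ∩ Metric.ball s 1 with hU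
  have hUo : IsOpen U := (isOpen_lt continuous_const Complex.continuous_re).inter Metric.isOpen_ball
  have hsU : s ∈ U := ⟨by simp only [mem_ofPred_eq]; linarith, Metric.mem_ball_self one_pos⟩
  have := differentiableOn_tsum_of_summable_norm (F := zetaRemainderTerm) (U := U)
    ((summable_nat_add_one_rpow (p := -(s.re / 2) - 1) (by linarith)).mul_left
      ((‖s‖ + 1) * (‖s‖ + 2))) ?_ hUo ?_
  · exact ((this s hsU).differentiableAt (hUo.mem_nhds hsU)).differentiableWithinAt
  · intro n z _
    have h1 : ((n : ℂ) + 1) ≠ 0 := by exact_mod_cast n.succ_ne_zero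
    have h2 : ((n : ℂ) + 1 + 1) ≠ 0 := by exact_mod_cast (n + 1).succ_ne_zero
    unfold zetaRemainderTerm
    refine DifferentiableAt.differentiableWithinAt ?_
    refine DifferentiableAt.sub (DifferentiableAt.mul (by fun_prop) ?_) (DifferentiableAt.sub ?_ ?_)
    · exact DifferentiableAt.const_cpow (by fun_prop) (Or.inl h1)
    · exact DifferentiableAt.const_cpow (by fun_prop) (Or.inl h1)
    · exact DifferentiableAt.const_cpow (by fun_prop) (Or.inl h2)
  · intro n z hz
    have hz1 : s.re / 2 < z.re := hz.1
    have hz2 : ‖z‖ ≤ ‖s‖ + 1 := by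
      have := norm_le_norm_add_norm_sub' z s
      linarith [mem_ball_iff_norm.1 hz.2]
    have hz3 : ‖z - 1‖ ≤ ‖s‖ + 2 := by
      have := norm_sub_le z 1
      rw [norm_one] at this
      linarith
    refine (norm_zetaRemainderTerm_le n ((half_pos hs).trans hz1)).trans ?_
    have hn : (1 : ℝ) ≤ (n : ℝ) + 1 := by linarith [n.cast_nonneg (α := ℝ)]
    gcongr

theorem tsum_zetaRemainderTerm_of_one_lt_re {s : ℂ} (hs : 1 < s.re) :
    riemannZeta₁ s = 1 + ∑' n, zetaRemainderTerm n s := by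
  have hs1 : s ≠ 1 := by rintro rfl; simp at hs
  have h1 : HasSum (fun n : ℕ ↦ ((n : ℂ) + 1) ^ (-s)) (riemannZeta s) := by
    rw [zeta_eq_tsum_one_div_nat_add_one_cpow hs]
    have h := (summable_nat_add_iff 1).2 (Complex.summable_one_div_nat_cpow.2 hs)
    simpa [Complex.cpow_neg] using h.hasSum
  have h2 := h1.mul_left (s - 1)
  have h3 : Summable fun n : ℕ ↦
      (((n : ℂ) + 1) ^ (1 - s) - ((n : ℂ) + 1 + 1) ^ (1 - s)) :=
    (h2.summable.sub (summable_zetaRemainderTerm (zero_lt_one.trans hs))).congr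
      fun n ↦ by rw [zetaRemainderTerm]; ring
  have h4 : HasSum (fun n : ℕ ↦ (((n : ℂ) + 1) ^ (1 - s) - ((n : ℂ) + 1 + 1) ^ (1 - s))) 1 := by
    rw [h3.hasSum_iff_tendsto_nat]
    have h5 : ∀ N : ℕ, ∑ n ∈ Finset.range N,
        (((n : ℂ) + 1) ^ (1 - s) - ((n : ℂ) + 1 + 1) ^ (1 - s)) = 1 - ((N : ℂ) + 1) ^ (1 - s) := by
      intro N
      have := Finset.sum_range_sub' (fun n : ℕ ↦ ((n : ℂ) + 1) ^ (1 - s)) N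
      simpa using this
    simp_rw [h5]
    have h6 : Tendsto (fun N : ℕ ↦ ((N : ℂ) + 1) ^ (1 - s)) atTop (𝓝 0) := by
      rw [tendsto_zero_iff_norm_tendsto_zero]
      have h7 : ∀ N : ℕ, ‖((N : ℂ) + 1) ^ (1 - s)‖ = ((N : ℝ) + 1) ^ (-(s.re - 1)) := by
        intro N
        have := norm_cpow_eq_rpow_re_of_pos (x := (N : ℝ) + 1) (by positivity) (1 - s)
        push_cast at this
        rw [this]
        simp
      simp_rw [h7]
      exact (tendsto_rpow_neg_atTop (sub_pos.2 hs)).comp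
        (tendsto_atTop_add_const_right _ _ tendsto_natCast_atTop_atTop)
    simpa using tendsto_const_nhds.sub h6
  have h5 : HasSum (fun n ↦ zetaRemainderTerm n s) ((s - 1) * riemannZeta s - 1) := h2.sub h4
  rw [h5.tsum_eq, riemannZeta_eq_inv_sub_mul hs1, mul_inv_cancel_left₀ (sub_ne_zero.2 hs1)]
  ring

theorem riemannZeta₁_eq_tsum_zetaRemainderTerm {s : ℂ} (hs : 0 < s.re) :
    riemannZeta₁ s = 1 + ∑' n, zetaRemainderTerm n s := by
  have hopen : IsOpen {s : ℂ | 0 < s.re} := isOpen_lt continuous_const Complex.continuous_re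
  refine AnalyticOnNhd.eqOn_of_preconnected_of_eventuallyEq (f := riemannZeta₁)
    (g := fun s ↦ 1 + ∑' n, zetaRemainderTerm n s) (z₀ := 2)
    (differentiable_riemannZeta₁.differentiableOn.analyticOnNhd hopen)
    ((differentiableOn_tsum_zetaRemainderTerm.const_add 1).analyticOnNhd hopen)
    (convex_halfSpace_re_gt 0).isPreconnected (by simp) ?_ hs
  filter_upwards [(isOpen_lt continuous_const Complex.continuous_re).mem_nhds
    (show (1 : ℝ) < (2 : ℂ).re by simp)] with z hz
  exact tsum_zetaRemainderTerm_of_one_lt_re hz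

/-- In the half-plane `σ ≤ re s`, `0 < σ`, and away from `1`, the Riemann zeta function grows at
most linearly. -/
theorem exists_norm_riemannZeta_le {σ : ℝ} (hσ : 0 < σ) :
    ∃ C : ℝ, 0 ≤ C ∧ ∀ s : ℂ, σ ≤ s.re → 1 ≤ |s.im| → ‖riemannZeta s‖ ≤ C * (1 + ‖s‖) := by
  have hsum := summable_nat_add_one_rpow (p := -σ - 1) (by linarith)
  set A : ℝ := ∑' n : ℕ, ((n : ℝ) + 1) ^ (-σ - 1) with hA
  have hA0 : 0 ≤ A := tsum_nonneg fun n ↦ by positivity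
  refine ⟨1 + A, by positivity, fun s h1 h2 ↦ ?_⟩
  have hs0 : 0 < s.re := hσ.trans_le h1
  have hs1 : 1 ≤ ‖s - 1‖ := by
    refine h2.trans ?_
    simpa using Complex.abs_im_le_norm (s - 1)
  have hne : s ≠ 1 := by
    rintro rfl
    simp at h2
    linarith
  have hT : ‖∑' n, zetaRemainderTerm n s‖ ≤ ‖s‖ * ‖s - 1‖ * A := by
    refine tsum_of_norm_bounded (hsum.hasSum.mul_left _) fun n ↦ ?_
    refine (norm_zetaRemainderTerm_le n hs0).trans ?_
    have hn : (1 : ℝ) ≤ (n : ℝ) + 1 := by linarith [n.cast_nonneg (α := ℝ)]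
    gcongr
  rw [riemannZeta_eq_inv_sub_mul hne, riemannZeta₁_eq_tsum_zetaRemainderTerm hs0, norm_mul,
    norm_inv, inv_mul_le_iff₀ (by positivity)]
  refine (norm_add_le _ _).trans ?_
  rw [norm_one]
  nlinarith [mul_nonneg (norm_nonneg s) hA0, norm_nonneg s, norm_nonneg (s - 1),
    mul_nonneg (norm_nonneg (s - 1)) hA0, mul_nonneg (norm_nonneg (s - 1)) (norm_nonneg s)]

theorem norm_cos_le_exp_abs_im (z : ℂ) : ‖Complex.cos z‖ ≤ Real.exp |z.im| := by
  rw [Complex.cos, norm_div, Complex.norm_two, div_le_iff₀ two_pos]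
  refine (norm_add_le _ _).trans ?_
  rw [Complex.norm_exp, Complex.norm_exp]
  have h1 : Real.exp (z * I).re ≤ Real.exp |z.im| := by
    gcongr; simpa using neg_le_abs z.im
  have h2 : Real.exp (-z * I).re ≤ Real.exp |z.im| := by
    gcongr; simpa using le_abs_self z.im
  linarith

/-- In a vertical strip the Riemann zeta function grows slower than any exponential. -/
theorem exists_norm_riemannZeta_le_exp {ε : ℝ} (hε : 0 < ε) (a b : ℝ) :
    ∃ C : ℝ, 0 ≤ C ∧ ∀ s : ℂ, a ≤ s.re → s.re ≤ b → 1 ≤ |s.im| →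
      ‖riemannZeta s‖ ≤ C * Real.exp (ε * |s.im|) := by
  have right : ∀ {ε : ℝ}, 0 < ε → ∀ b : ℝ, ∃ C : ℝ, 0 ≤ C ∧ ∀ s : ℂ, 1 / 4 ≤ s.re → s.re ≤ b →
      1 ≤ |s.im| → ‖riemannZeta s‖ ≤ C * Real.exp (ε * |s.im|) := by
    intro ε hε b
    obtain ⟨C, hC0, hC⟩ := exists_norm_riemannZeta_le (σ := 1 / 4) (by norm_num)
    refine ⟨C * (1 + |b| + 1 / ε), by positivity, fun s h1 h2 h3 ↦ (hC s h1 h3).trans ?_⟩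
    rw [mul_assoc]
    gcongr
    have h4 : ‖s‖ ≤ |b| + |s.im| := by
      refine (Complex.norm_le_abs_re_add_abs_im s).trans ?_
      have : |s.re| = s.re := abs_of_nonneg (by linarith)
      linarith [le_abs_self b]
    have h5 : ε * |s.im| + 1 ≤ Real.exp (ε * |s.im|) := Real.add_one_le_exp _
    have h6 : 1 ≤ Real.exp (ε * |s.im|) := Real.one_le_exp (by positivity)
    have h7 : |s.im| ≤ 1 / ε * Real.exp (ε * |s.im|) := by
      rw [one_div, ← div_eq_inv_mul, le_div_iff₀ hε]
      linarith
    nlinarith [mul_le_mul_of_nonneg_left h6 (show 0 ≤ 1 + |b| by positivity)]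
  have left : ∃ C : ℝ, 0 ≤ C ∧ ∀ s : ℂ, 1 / 4 ≤ s.re → s.re ≤ 1 - a →
      1 ≤ |s.im| → ‖riemannZeta (1 - s)‖ ≤ C * Real.exp (ε * |s.im|) := by
    set η : ℝ := min (ε / 2) 1 with hη
    have hη0 : 0 < η := lt_min (half_pos hε) one_pos
    have hη1 : η ≤ ε / 2 := min_le_left _ _
    have hη2 : η ≤ 1 := min_le_right _ _
    obtain ⟨C₁, hC₁0, hC₁⟩ := right hη0 (1 - a)
    obtain ⟨C₂, hC₂0, hC₂⟩ := exists_norm_Gamma_le_exp (φ := π / 2 - η)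
      (by linarith [pi_gt_three]) (by linarith) one_pos (1 / 4) (1 - a)
    refine ⟨2 * C₂ * C₁, by positivity, fun s h1 h2 h3 ↦ ?_⟩
    have hn : ∀ n : ℕ, s ≠ -n := by
      rintro n rfl
      simp at h3
      linarith
    have hne : s ≠ 1 := by
      rintro rfl
      simp at h3
      linarith
    rw [riemannZeta_one_sub hn hne, norm_mul, norm_mul, norm_mul, norm_mul, Complex.norm_two]
    have e1 : ‖(2 * (π : ℂ)) ^ (-s)‖ ≤ 1 := by
      have h := norm_cpow_eq_rpow_re_of_pos (x := 2 * π) (by positivity) (-s)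
      push_cast at h
      rw [h, Complex.neg_re]
      exact Real.rpow_le_one_of_one_le_of_nonpos (by linarith [pi_gt_three]) (by linarith)
    have e2 : ‖Complex.cos (π * s / 2)‖ ≤ Real.exp (π / 2 * |s.im|) := by
      refine (norm_cos_le_exp_abs_im _).trans_eq ?_
      have : ((π : ℂ) * s / 2).im = π / 2 * s.im := by
        rw [show (π : ℂ) * s / 2 = ((π / 2 : ℝ) : ℂ) * s by push_cast; ring,
          Complex.im_ofReal_mul]
      rw [this, abs_mul, abs_of_pos (by positivity : 0 < π / 2)]
    calc 2 * ‖(2 * (π : ℂ)) ^ (-s)‖ * ‖Complex.Gamma s‖ * ‖Complex.cos (π * s / 2)‖ *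
          ‖riemannZeta s‖
        ≤ 2 * 1 * (C₂ * Real.exp (-(π / 2 - η) * |s.im|)) * Real.exp (π / 2 * |s.im|) *
          (C₁ * Real.exp (η * |s.im|)) := by
          gcongr
          · exact hC₂ s h1 h2 h3
          · exact hC₁ s h1 h2 h3
      _ = 2 * C₂ * C₁ * Real.exp (-(π / 2 - η) * |s.im| + π / 2 * |s.im| + η * |s.im|) := by
          rw [Real.exp_add, Real.exp_add]; ring
      _ ≤ 2 * C₂ * C₁ * Real.exp (ε * |s.im|) := by
          gcongr
          nlinarith [abs_nonneg s.im]
  obtain ⟨C₁, hC₁0, hC₁⟩ := right hε b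
  obtain ⟨C₂, hC₂0, hC₂⟩ := left
  refine ⟨max C₁ C₂, hC₁0.trans (le_max_left _ _), fun s h1 h2 h3 ↦ ?_⟩
  rcases le_total (1 / 4) s.re with h | h
  · refine (hC₁ s h h2 h3).trans ?_
    gcongr
    exact le_max_left _ _
  · have := hC₂ (1 - s) (by simp; linarith)
      (by rw [Complex.sub_re, Complex.one_re]; linarith) (by simpa using h3)
    simp only [sub_sub_cancel, Complex.sub_im, Complex.one_im, zero_sub, abs_neg] at this
    refine this.trans ?_
    gcongr
    exact le_max_right _ _

theorem integrable_of_norm_le_exp_neg_abs {f : ℝ → ℂ} (hf : Continuous f) {C c : ℝ} (hc : 0 < c)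
    (hb : ∀ y : ℝ, 1 ≤ |y| → ‖f y‖ ≤ C * Real.exp (-c * |y|)) : Integrable f := by
  refine hf.locallyIntegrable.integrable_of_isBigO_atBot_atTop
    (g := fun y ↦ Real.exp (c * y)) (g' := fun y ↦ Real.exp (-c * y)) ?_ ?_ ?_ ?_
  · refine IsBigO.of_bound C ?_
    filter_upwards [eventually_le_atBot (-1)] with y hy
    have h : |y| = -y := abs_of_neg (by linarith)
    have := hb y (by rw [h]; linarith)
    rwa [h, neg_mul_neg, ← Real.norm_of_nonneg (Real.exp_pos (c * y)).le] at this
  · exact ⟨Iic 0, Iic_mem_atBot 0, integrableOn_exp_mul_Iic hc 0⟩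
  · refine IsBigO.of_bound C ?_
    filter_upwards [eventually_ge_atTop 1] with y hy
    have h : |y| = y := abs_of_pos (by linarith)
    have := hb y (by rwa [h])
    rwa [h, ← Real.norm_of_nonneg (Real.exp_pos (-c * y)).le] at this
  · exact ⟨Ioi 0, Ioi_mem_atTop 0, exp_neg_integrableOn_Ioi 0 hc⟩

theorem continuous_comp_vertical_line {g : ℂ → ℂ} {U : Set ℂ} (hU : IsOpen U)
    (hg : DifferentiableOn ℂ g U) {σ : ℝ} (hσ : ∀ y : ℝ, (σ + y * I : ℂ) ∈ U) :
    Continuous fun y : ℝ ↦ g (σ + y * I) := by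
  refine continuous_iff_continuousAt.2 fun y ↦ ?_
  exact ContinuousAt.comp (f := fun y : ℝ ↦ (σ + y * I : ℂ)) (g := g)
    (hg.differentiableAt (hU.mem_nhds (hσ y))).continuousAt
    (Continuous.continuousAt (by fun_prop))

/-- Cauchy's theorem for an infinite vertical strip on which the function decays exponentially. -/
theorem integral_vertical_line_eq {g : ℂ → ℂ} {U : Set ℂ} (hU : IsOpen U)
    (hg : DifferentiableOn ℂ g U) {σ₁ σ₂ C c : ℝ} (hσ : σ₁ ≤ σ₂) (hc : 0 < c)
    (hsub : ∀ s : ℂ, σ₁ ≤ s.re → s.re ≤ σ₂ → s ∈ U)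
    (hb : ∀ s : ℂ, σ₁ ≤ s.re → s.re ≤ σ₂ → 1 ≤ |s.im| → ‖g s‖ ≤ C * Real.exp (-c * |s.im|)) :
    ∫ y : ℝ, g (σ₁ + y * I) = ∫ y : ℝ, g (σ₂ + y * I) := by
  have hint : ∀ σ : ℝ, σ₁ ≤ σ → σ ≤ σ₂ → Integrable fun y : ℝ ↦ g (σ + y * I) := by
    intro σ h1 h2
    refine integrable_of_norm_le_exp_neg_abs (C := C) (c := c)
      (continuous_comp_vertical_line hU hg fun y ↦ hsub _ (by simpa) (by simpa)) hc fun y hy ↦ ?_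
    simpa using hb (σ + y * I) (by simpa) (by simpa) (by simpa)
  have hlim : ∀ σ : ℝ, σ₁ ≤ σ → σ ≤ σ₂ →
      Tendsto (fun T : ℝ ↦ ∫ y : ℝ in -T..T, g (σ + y * I)) atTop
        (𝓝 (∫ y : ℝ, g (σ + y * I))) := fun σ h1 h2 ↦
    intervalIntegral_tendsto_integral (hint σ h1 h2) tendsto_neg_atTop_atBot tendsto_id
  have hexp : Tendsto (fun T : ℝ ↦ C * Real.exp (-c * T) * |σ₂ - σ₁|) atTop (𝓝 0) := by
    have h : Tendsto (fun T : ℝ ↦ Real.exp (-c * T)) atTop (𝓝 0) :=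
      Real.tendsto_exp_atBot.comp (tendsto_id.const_mul_atTop_of_neg (neg_lt_zero.2 hc))
    simpa using (h.const_mul C).mul_const |σ₂ - σ₁|
  have hhor : ∀ ε : ℝ, |ε| = 1 →
      Tendsto (fun T : ℝ ↦ ∫ x : ℝ in σ₁..σ₂, g (x + (ε * T : ℝ) * I)) atTop (𝓝 0) := by
    intro ε hε
    refine squeeze_zero_norm' ?_ hexp
    filter_upwards [eventually_ge_atTop 1] with T hT
    refine intervalIntegral.norm_integral_le_of_norm_le_const fun x hx ↦ ?_
    rw [uIoc_of_le hσ] at hx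
    have hT' : |ε * T| = T := by rw [abs_mul, hε, one_mul, abs_of_nonneg (by linarith)]
    have him : ((x : ℂ) + (ε * T : ℝ) * I).im = ε * T := by
      rw [Complex.add_im, Complex.im_ofReal_mul]; simp
    have hre : ((x : ℂ) + (ε * T : ℝ) * I).re = x := by
      rw [Complex.add_re, Complex.re_ofReal_mul]; simp
    have := hb (x + (ε * T : ℝ) * I) (by rw [hre]; exact hx.1.le) (by rw [hre]; exact hx.2)
      (by rwa [him, hT'])
    rwa [him, hT'] at this
  have hrect : ∀ T : ℝ, (∫ x : ℝ in σ₁..σ₂, g (x + ((-1) * T : ℝ) * I)) -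
      (∫ x : ℝ in σ₁..σ₂, g (x + (1 * T : ℝ) * I)) + I • (∫ y : ℝ in -T..T, g (σ₂ + y * I)) -
      I • (∫ y : ℝ in -T..T, g (σ₁ + y * I)) = 0 := by
    intro T
    have := Complex.integral_boundary_rect_eq_zero_of_differentiableOn g
      ⟨σ₁, -T⟩ ⟨σ₂, T⟩ (hg.mono fun s hs ↦ ?_)
    · simpa using this
    · have h := hs.1
      simp only [mem_preimage, uIcc_of_le hσ] at h
      exact hsub s h.1 h.2
  have hfin := ((((hhor (-1) (by simp)).sub (hhor 1 (by simp))).add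
    ((hlim σ₂ hσ le_rfl).const_smul I)).sub ((hlim σ₁ le_rfl hσ).const_smul I))
  simp_rw [hrect] at hfin
  have h0 := tendsto_nhds_unique hfin tendsto_const_nhds
  rw [sub_zero, zero_add, ← smul_sub, smul_eq_zero, sub_eq_zero] at h0
  exact (h0.resolve_left I_ne_zero).symm

/-- A function with finitely many isolated singularities, all of them removable, extends
holomorphically. -/
theorem exists_differentiableOn_of_finite_removable {E : ℂ → ℂ} {U T : Set ℂ} (hU : IsOpen U)
    (hT : T.Finite) (hd : ∀ z ∈ U, z ∉ T → DifferentiableAt ℂ E z)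
    (hlim : ∀ p ∈ T, Tendsto (fun z ↦ (z - p) * E z) (𝓝[≠] p) (𝓝 0)) :
    ∃ g : ℂ → ℂ, DifferentiableOn ℂ g U ∧ ∀ z ∉ T, g z = E z := by
  classical
  refine ⟨fun z ↦ if z ∈ T then limUnder (𝓝[≠] z) E else E z, fun z hz ↦ ?_, fun z hz ↦ if_neg hz⟩
  refine DifferentiableAt.differentiableWithinAt ?_
  by_cases hzT : z ∈ T
  · have hV : U ∩ (T \ {z})ᶜ ∈ 𝓝 z :=
      (hU.inter (hT.subset sdiff_subset).isClosed.isOpen_compl).mem_nhds ⟨hz, by simp⟩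
    have hdV : DifferentiableOn ℂ E ((U ∩ (T \ {z})ᶜ) \ {z}) := by
      rintro w ⟨⟨hw1, hw2⟩, hw3⟩
      exact (hd w hw1 fun h ↦ hw2 ⟨h, hw3⟩).differentiableWithinAt
    have ho : (fun w ↦ E w - E z) =o[𝓝[≠] z] fun w ↦ (w - z)⁻¹ := by
      refine (isLittleO_iff_tendsto' ?_).2 ?_
      · filter_upwards [self_mem_nhdsWithin] with w hw h
        exact absurd (inv_eq_zero.1 h) (sub_ne_zero.2 hw)
      · have h1 : Tendsto (fun w : ℂ ↦ (w - z) * E z) (𝓝[≠] z) (𝓝 0) :=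
          (Continuous.tendsto' (by fun_prop) z 0 (by simp)).mono_left nhdsWithin_le_nhds
        have h2 := (hlim z hzT).sub h1
        rw [sub_zero] at h2
        refine h2.congr fun w ↦ ?_
        rw [div_inv_eq_mul]
        ring
    have h := (Complex.differentiableOn_update_limUnder_of_isLittleO hV hdV ho).differentiableAt hV
    refine h.congr_of_eventuallyEq ?_
    filter_upwards [hV] with w hw
    by_cases hwz : w = z
    · subst hwz
      simp [hzT]
    · have hwT : w ∉ T := fun h ↦ hw.2 ⟨h, hwz⟩
      simp [hwT, hwz]
  · refine (hd z hz hzT).congr_of_eventuallyEq ?_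
    filter_upwards [hT.isClosed.isOpen_compl.mem_nhds hzT] with w hw
    exact if_neg hw

/-- The Mellin transform of `t ^ (-p) * exp (-t ^ L)`. -/
theorem hasMellin_cpow_mul_exp_neg_rpow {p L : ℝ} (hL : 0 < L) {s : ℂ} (hs : p < s.re) :
    HasMellin (fun t : ℝ ↦ (t : ℂ) ^ (-p : ℂ) * (Real.exp (-t ^ L) : ℂ)) s
      ((L : ℂ)⁻¹ * Complex.Gamma ((s - p) / L)) := by
  have hz : 0 < ((s + -p) / L).re := by
    rw [Complex.div_ofReal_re]
    refine div_pos ?_ hL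
    simp
    linarith
  have h1 : MellinConvergent (fun t : ℝ ↦ (Real.exp (-t) : ℂ)) ((s + -p) / L) := by
    refine (Complex.GammaIntegral_convergent hz).congr_fun (fun t _ ↦ ?_) measurableSet_Ioi
    simp [mul_comm]
  constructor
  · have h2 := (MellinConvergent.comp_rpow hL.ne').2 h1
    exact MellinConvergent.cpow_smul.2 h2
  · have h3 := mellin_cpow_smul (fun t : ℝ ↦ (Real.exp (-t ^ L) : ℂ)) s (-p)
    simp only [smul_eq_mul] at h3
    rw [h3, mellin_comp_rpow (fun t : ℝ ↦ (Real.exp (-t) : ℂ)), abs_of_pos hL,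
      ← Complex.GammaIntegral_eq_mellin, ← Complex.Gamma_eq_integral hz, sub_eq_add_neg]
    simp

theorem differentiableAt_Gamma_sub_div {p L : ℝ} (hL : 0 < L) {s : ℂ} (hs : p - L < s.re)
    (hne : s ≠ p) : DifferentiableAt ℂ (fun s : ℂ ↦ Complex.Gamma ((s - p) / L)) s := by
  have hL0 : (L : ℂ) ≠ 0 := Complex.ofReal_ne_zero.2 hL.ne'
  refine DifferentiableAt.comp (g := Complex.Gamma) (f := fun s : ℂ ↦ (s - p) / L) s
    (Complex.differentiableAt_Gamma _ fun m hm ↦ ?_) (by fun_prop)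
  rw [div_eq_iff hL0] at hm
  rcases m.eq_zero_or_pos with rfl | hm0
  · rw [Nat.cast_zero, neg_zero, zero_mul, sub_eq_zero] at hm
    exact hne hm
  · have h1 := congrArg Complex.re hm
    have hm1 : (1 : ℝ) ≤ m := by exact_mod_cast hm0
    simp at h1
    nlinarith

theorem tendsto_sub_mul_Gamma_sub_div {p L : ℝ} (hL : 0 < L) :
    Tendsto (fun s : ℂ ↦ (s - p) * ((L : ℂ)⁻¹ * Complex.Gamma ((s - p) / L))) (𝓝[≠] (p : ℂ))
      (𝓝 1) := by
  have hL0 : (L : ℂ) ≠ 0 := Complex.ofReal_ne_zero.2 hL.ne'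
  have h : Tendsto (fun s : ℂ ↦ (s - p) / L) (𝓝[≠] (p : ℂ)) (𝓝[≠] 0) := by
    refine tendsto_nhdsWithin_iff.2 ⟨?_, ?_⟩
    · exact (Continuous.tendsto' (by fun_prop) _ _ (by simp)).mono_left nhdsWithin_le_nhds
    · filter_upwards [self_mem_nhdsWithin] with s hs
      exact div_ne_zero (sub_ne_zero.2 hs) hL0
  refine (Complex.tendsto_self_mul_Gamma_nhds_zero.comp h).congr fun s ↦ ?_
  simp only [Function.comp]
  ring

theorem exists_norm_Gamma_sub_div_le {p L : ℝ} (hL : 0 < L) (σ₁ σ₂ : ℝ) :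
    ∃ C : ℝ, 0 ≤ C ∧ ∀ s : ℂ, σ₁ ≤ s.re → s.re ≤ σ₂ → 1 ≤ |s.im| →
      ‖Complex.Gamma ((s - p) / L)‖ ≤ C * Real.exp (-(1 / L) * |s.im|) := by
  obtain ⟨C, hC0, hC⟩ := exists_norm_Gamma_le_exp zero_le_one (by linarith [pi_gt_three])
    (one_div_pos.2 hL) ((σ₁ - p) / L) ((σ₂ - p) / L)
  refine ⟨C, hC0, fun s h1 h2 h3 ↦ ?_⟩
  have hre : ((s - p) / L).re = (s.re - p) / L := by rw [Complex.div_ofReal_re]; simp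
  have him : |((s - p) / L).im| = |s.im| / L := by
    rw [Complex.div_ofReal_im, abs_div, abs_of_pos hL]; simp
  have := hC ((s - p) / L) (by rw [hre]; gcongr) (by rw [hre]; gcongr) (by rw [him]; gcongr)
  rw [him] at this
  refine this.trans_eq ?_
  congr 2
  ring

theorem exists_norm_le_rpow_of_hasMellin {f : ℝ → ℂ} {g : ℂ → ℂ} {U : Set ℂ} (hU : IsOpen U)
    (hg : DifferentiableOn ℂ g U) {σ₁ σ₂ C c : ℝ} (hσ : σ₁ ≤ σ₂) (hc : 0 < c)
    (hsub : ∀ s : ℂ, σ₁ ≤ s.re → s.re ≤ σ₂ → s ∈ U)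
    (hb : ∀ s : ℂ, σ₁ ≤ s.re → s.re ≤ σ₂ → 1 ≤ |s.im| → ‖g s‖ ≤ C * Real.exp (-c * |s.im|))
    (hm : ∀ s : ℂ, s.re = σ₂ → HasMellin f s (g s)) (hf : ∀ x : ℝ, 0 < x → ContinuousAt f x) :
    ∃ K : ℝ, ∀ x : ℝ, 0 < x → ‖f x‖ ≤ K * x ^ (-σ₁) := by
  have hcpow : ∀ x : ℝ, 0 < x → ∀ s : ℂ, ‖(x : ℂ) ^ (-s)‖ = x ^ (-s.re) := fun x hx s ↦ by
    rw [Complex.norm_cpow_eq_rpow_re_of_pos hx, Complex.neg_re]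
  refine ⟨(2 * π)⁻¹ * ∫ y : ℝ, ‖g (σ₁ + y * I)‖, fun x hx ↦ ?_⟩
  have hx0 : (x : ℂ) ≠ 0 := Complex.ofReal_ne_zero.2 hx.ne'
  have hline : ∀ y : ℝ, mellin f (σ₂ + y * I) = g (σ₂ + y * I) := fun y ↦
    (hm _ (by simp)).2
  have hvert : Complex.VerticalIntegrable (mellin f) σ₂ := by
    unfold Complex.VerticalIntegrable
    simp_rw [hline]
    refine integrable_of_norm_le_exp_neg_abs (C := C) (c := c)
      (continuous_comp_vertical_line hU hg fun y ↦ hsub _ (by simpa) (by simp)) hc fun y hy ↦ ?_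
    simpa using hb (σ₂ + y * I) (by simpa) (by simp) (by simpa)
  have hinv := mellinInv_mellin_eq σ₂ f hx (hm σ₂ (by simp)).1 hvert (hf x hx)
  have hshift := integral_vertical_line_eq (g := fun s ↦ (x : ℂ) ^ (-s) * g s)
    (C := (x ^ (-σ₁) + x ^ (-σ₂)) * C) (c := c) hU
    (DifferentiableOn.mul (fun s _ ↦ by
      refine DifferentiableAt.differentiableWithinAt ?_
      exact DifferentiableAt.const_cpow (by fun_prop) (Or.inl hx0)) hg) hσ hc hsub
    (fun s h1 h2 h3 ↦ by
      rw [norm_mul, mul_assoc, hcpow x hx]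
      refine mul_le_mul ?_ (hb s h1 h2 h3) (norm_nonneg _) (by positivity)
      rcases le_total 1 x with h | h
      · exact (Real.rpow_le_rpow_of_exponent_le h (neg_le_neg h1)).trans
          (le_add_of_nonneg_right (by positivity))
      · exact (Real.rpow_le_rpow_of_exponent_ge hx h (neg_le_neg h2)).trans
          (le_add_of_nonneg_left (by positivity)))
  rw [← hinv, mellinInv]
  simp_rw [hline, smul_eq_mul]
  rw [← hshift, norm_smul, Real.norm_of_nonneg (by positivity), one_div, mul_assoc]
  gcongr
  refine (norm_integral_le_integral_norm _).trans_eq ?_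
  rw [← integral_mul_const]
  refine integral_congr_ae (Eventually.of_forall fun y ↦ ?_)
  simp only [norm_mul, hcpow x hx]
  simp [mul_comm]

/-- A meromorphic Mellin transform with finitely many simple poles on the real line gives the
asymptotic expansion at zero. -/
theorem exists_norm_sub_sum_le_of_hasMellin {ι : Type*} (S : Finset ι) {p : ι → ℝ}
    (hp : Set.InjOn p S) {c : ι → ℂ} {φ : ℂ → ℂ} {f : ℝ → ℂ} {σ₀ σ₁ σ₂ L C b : ℝ}
    (h01 : σ₀ < σ₁) (h12 : σ₁ ≤ σ₂) (hL : 0 < L) (hb0 : 0 < b)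
    (hpL : ∀ i ∈ S, p i - L ≤ σ₀) (hp0 : ∀ i ∈ S, σ₀ < p i)
    (hp2 : ∀ i ∈ S, p i < σ₂)
    (hφ : ∀ s : ℂ, σ₀ < s.re → (∀ i ∈ S, s ≠ p i) → DifferentiableAt ℂ φ s)
    (hres : ∀ i ∈ S, Tendsto (fun s ↦ (s - p i) * φ s) (𝓝[≠] (p i : ℂ)) (𝓝 (c i)))
    (hb : ∀ s : ℂ, σ₁ ≤ s.re → s.re ≤ σ₂ → 1 ≤ |s.im| → ‖φ s‖ ≤ C * Real.exp (-b * |s.im|))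
    (hm : ∀ s : ℂ, s.re = σ₂ → HasMellin f s (φ s)) (hf : ∀ x : ℝ, 0 < x → ContinuousAt f x) :
    ∃ K : ℝ, ∀ x : ℝ, 0 < x →
      ‖f x - ∑ i ∈ S, c i * ((x : ℂ) ^ (-p i : ℂ) * (Real.exp (-x ^ L) : ℂ))‖ ≤
        K * x ^ (-σ₁) := by
  classical
  set G : ι → ℂ → ℂ := fun i s ↦ (L : ℂ)⁻¹ * Complex.Gamma ((s - p i) / L) with hG
  set E : ℂ → ℂ := fun s ↦ φ s - ∑ i ∈ S, c i * G i s with hE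
  set U : Set ℂ := {s | σ₀ < s.re} with hUdef
  set T : Set ℂ := (fun i ↦ (p i : ℂ)) '' S with hTdef
  have hU : IsOpen U := isOpen_lt continuous_const Complex.continuous_re
  have hT : T.Finite := S.finite_toSet.image _
  have hGd : ∀ i ∈ S, ∀ s ∈ U, s ≠ p i → DifferentiableAt ℂ (G i) s := fun i hi s hs hne ↦
    (differentiableAt_Gamma_sub_div hL ((hpL i hi).trans_lt hs) hne).const_mul _
  have hmemT : ∀ s, s ∉ T ↔ ∀ i ∈ S, s ≠ p i := by
    intro s
    simp only [hTdef, Set.mem_image, not_exists, not_and, Finset.mem_coe, ne_eq, eq_comm]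
  have hEd : ∀ z ∈ U, z ∉ T → DifferentiableAt ℂ E z := by
    intro z hz hzT
    rw [hmemT] at hzT
    exact (hφ z hz hzT).sub
      (DifferentiableAt.fun_sum fun i hi ↦ (hGd i hi z hz (hzT i hi)).const_mul _)
  have hElim : ∀ q ∈ T, Tendsto (fun z ↦ (z - q) * E z) (𝓝[≠] q) (𝓝 0) := by
    rintro _ ⟨j, hj, rfl⟩
    have hj : j ∈ S := hj
    have hG' : ∀ i ∈ S, Tendsto (fun z ↦ c i * ((z - p j) * G i z)) (𝓝[≠] (p j : ℂ))
        (𝓝 (if i = j then c j else 0)) := by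
      intro i hi
      split_ifs with hij
      · subst hij
        simpa using (tendsto_sub_mul_Gamma_sub_div (p := p i) hL).const_mul (c i)
      · have h1 : ContinuousAt (fun z : ℂ ↦ c i * ((z - p j) * G i z)) (p j) := by
          refine ContinuousAt.mul continuousAt_const (ContinuousAt.mul (by fun_prop) ?_)
          refine (hGd i hi _ (by simpa [hUdef] using hp0 j hj) fun h ↦ hij ?_).continuousAt
          exact hp hi hj (Complex.ofReal_injective h.symm)
        have h2 := h1.tendsto.mono_left (nhdsWithin_le_nhds (s := {(p j : ℂ)}ᶜ))
        simpa using h2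
    have h := (hres j hj).sub (tendsto_finsetSum S hG')
    rw [Finset.sum_ite_eq' S j, if_pos hj, sub_self] at h
    refine h.congr fun z ↦ ?_
    simp only [hE, mul_sub, Finset.mul_sum]
    congr 1
    exact Finset.sum_congr rfl fun i _ ↦ by ring
  obtain ⟨g, hgU, hgE⟩ := exists_differentiableOn_of_finite_removable hU hT hEd hElim
  have hnT : ∀ s : ℂ, 1 ≤ |s.im| → s ∉ T := by
    rintro s hs ⟨i, -, rfl⟩
    norm_num at hs
  have hnT2 : ∀ s : ℂ, s.re = σ₂ → s ∉ T := by
    rintro s hs ⟨i, hi, rfl⟩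
    exact (hp2 i hi).ne (by simpa using hs)
  have hGb : ∀ i, ∃ D : ℝ, 0 ≤ D ∧ ∀ s : ℂ, σ₁ ≤ s.re → s.re ≤ σ₂ → 1 ≤ |s.im| →
      ‖G i s‖ ≤ D * Real.exp (-(1 / L) * |s.im|) := by
    intro i
    obtain ⟨D, hD0, hD⟩ := exists_norm_Gamma_sub_div_le (p := p i) hL σ₁ σ₂
    refine ⟨L⁻¹ * D, by positivity, fun s h1 h2 h3 ↦ ?_⟩
    rw [hG, norm_mul, norm_inv, Complex.norm_real, Real.norm_of_nonneg hL.le, mul_assoc]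
    gcongr
    exact hD s h1 h2 h3
  choose D hD0 hD using hGb
  have hexp : ∀ {u v t : ℝ}, u ≤ v → 0 ≤ t → Real.exp (-v * t) ≤ Real.exp (-u * t) := by
    intro u v t h ht
    gcongr
  set m := min b (1 / L) with hmdef
  have hgb : ∀ s : ℂ, σ₁ ≤ s.re → s.re ≤ σ₂ → 1 ≤ |s.im| →
      ‖g s‖ ≤ (|C| + ∑ i ∈ S, ‖c i‖ * D i) * Real.exp (-m * |s.im|) := by
    intro s h1 h2 h3
    rw [hgE s (hnT s h3), add_mul, Finset.sum_mul]
    refine (norm_sub_le _ _).trans (add_le_add ?_ ((norm_sum_le _ _).trans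
      (Finset.sum_le_sum fun i _ ↦ ?_)))
    · refine (hb s h1 h2 h3).trans (mul_le_mul (le_abs_self C)
        (hexp (min_le_left _ _) (abs_nonneg _))
        (Real.exp_pos _).le (abs_nonneg _))
    · rw [norm_mul, mul_assoc]
      gcongr
      exact (hD i s h1 h2 h3).trans (mul_le_mul_of_nonneg_left
        (hexp (min_le_right _ _) (abs_nonneg _)) (hD0 i))
  set P : ι → ℝ → ℂ := fun i t ↦ c i * ((t : ℂ) ^ (-p i : ℂ) * (Real.exp (-t ^ L) : ℂ)) with hP
  have hPm : ∀ i ∈ S, ∀ s : ℂ, s.re = σ₂ → HasMellin (P i) s (c i * G i s) := by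
    intro i hi s hs
    have h := hasMellin_cpow_mul_exp_neg_rpow (p := p i) hL (s := s) (by rw [hs]; exact hp2 i hi)
    have h2 := hasMellin_const_smul h.1 (c i)
    rw [h.2] at h2
    exact h2
  have hsum : ∀ A : Finset ι, A ⊆ S → ∀ s : ℂ, s.re = σ₂ →
      HasMellin (fun t ↦ ∑ i ∈ A, P i t) s (∑ i ∈ A, c i * G i s) := by
    intro A
    induction A using Finset.induction_on with
    | empty =>
      intro _ s _
      simp [HasMellin, MellinConvergent, mellin]
    | insert a A ha ih =>
      intro hA s hs
      simp_rw [Finset.sum_insert ha]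
      have h1 := hPm a (hA (Finset.mem_insert_self a A)) s hs
      have h2 := ih ((Finset.subset_insert a A).trans hA) s hs
      have h3 := hasMellin_add h1.1 h2.1
      rwa [h1.2, h2.2] at h3
  refine exists_norm_le_rpow_of_hasMellin
    (f := fun x ↦ f x - ∑ i ∈ S, P i x) hU hgU h12 (lt_min hb0 (one_div_pos.2 hL))
    (fun s h _ ↦ h01.trans_le h) hgb (fun s hs ↦ ?_) fun x hx ↦ ?_
  · have h1 := hm s hs
    have h2 := hsum S subset_rfl s hs
    have h3 := hasMellin_sub h1.1 h2.1
    rw [h1.2, h2.2] at h3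
    rwa [hgE s (hnT2 s hs)]
  · refine (hf x hx).sub (tendsto_finsetSum _ fun i _ ↦ ?_)
    have h1 : ContinuousAt (fun t : ℝ ↦ (t : ℂ) ^ (-p i : ℂ)) x :=
      Complex.continuousAt_ofReal_cpow_const _ _ (Or.inr hx.ne')
    have h2 : ContinuousAt (fun t : ℝ ↦ (Real.exp (-t ^ L) : ℂ)) x :=
      Complex.continuous_ofReal.continuousAt.comp (Real.continuous_exp.continuousAt.comp
        (Real.continuousAt_rpow_const x L (Or.inl hx.ne')).neg)
    exact (h1.mul h2).const_mul (c i)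

theorem LSeriesHasSum_natCast {w : ℂ} (hw : 2 < w.re) :
    LSeriesHasSum (fun n : ℕ ↦ (n : ℂ)) w (riemannZeta (w - 1)) := by
  have h := LSeriesHasSum_one (s := w - 1) (by simp; linarith)
  unfold LSeriesHasSum at h ⊢
  convert h using 1
  funext n
  rcases eq_or_ne n 0 with rfl | hn
  · simp
  · rw [LSeries.term_of_ne_zero hn, LSeries.term_of_ne_zero hn,
      Complex.cpow_sub _ _ (by exact_mod_cast hn)]
    simp

theorem LSeriesHasSum_sum_divisors {w : ℂ} (hw : 2 < w.re) :
    LSeriesHasSum (fun n : ℕ ↦ ((∑ d ∈ n.divisors, d : ℕ) : ℂ)) w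
      (riemannZeta w * riemannZeta (w - 1)) := by
  have h := (LSeriesHasSum_one (s := w) (by linarith)).convolution (LSeriesHasSum_natCast hw)
  rwa [LSeriesHasSum_congr w _ (g := fun n : ℕ ↦ ((∑ d ∈ n.divisors, d : ℕ) : ℂ))] at h
  intro n _
  rw [LSeries.convolution_def]
  simp [Nat.sum_divisorsAntidiagonal' (f := fun _ y ↦ (y : ℂ))]

theorem sum_divisors_le_sq (n : ℕ) : ∑ d ∈ n.divisors, d ≤ n ^ 2 := by
  calc ∑ d ∈ n.divisors, d ≤ ∑ _d ∈ n.divisors, n := Finset.sum_le_sum fun d ↦ Nat.divisor_le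
    _ = n.divisors.card * n := by simp
    _ ≤ n ^ 2 := by rw [sq]; exact Nat.mul_le_mul_right n (Nat.card_divisors_le_self n)

theorem norm_sum_divisors_div_sqrt_le (n : ℕ) :
    ‖((∑ d ∈ (n + 1 : ℕ).divisors, d : ℕ) : ℂ) / ((n + 1 : ℕ) : ℂ) ^ ((1 : ℂ) / 2)‖ ≤
      ((n : ℝ) + 1) ^ (2 : ℝ) := by
  have h1 : (1 : ℝ) ≤ ‖((n + 1 : ℕ) : ℂ) ^ ((1 : ℂ) / 2)‖ := by
    rw [Complex.norm_natCast_cpow_of_pos n.succ_pos]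
    exact Real.one_le_rpow (by simp) (by norm_num)
  rw [norm_div, Complex.norm_natCast]
  refine (div_le_self (by positivity) h1).trans ?_
  rw [Real.rpow_two]
  exact_mod_cast sum_divisors_le_sq (n + 1)

theorem exp_neg_le_mul_rpow {k u : ℝ} (hk : 0 < k) (hu : 0 < u) :
    Real.exp (-u) ≤ k ^ k * u ^ (-k) := by
  have h : (u / k) ^ k ≤ Real.exp u := by
    calc (u / k) ^ k ≤ Real.exp (u / k) ^ k :=
          Real.rpow_le_rpow (by positivity) (by linarith [Real.add_one_le_exp (u / k)]) hk.le
      _ = Real.exp u := by rw [← Real.exp_mul, div_mul_cancel₀ _ hk.ne']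
  rw [Real.exp_neg, Real.rpow_neg hu.le, ← div_eq_mul_inv, ← inv_div]
  refine inv_anti₀ (by positivity) ?_
  rwa [← Real.div_rpow hu.le hk.le]

section squares

variable {a : ℕ → ℂ}

theorem norm_mul_exp_neg_sq_le (ha : ∀ n, ‖a n‖ ≤ ((n : ℝ) + 1) ^ (2 : ℝ)) {k : ℝ} (hk : 0 < k)
    (n : ℕ) {t : ℝ} (ht : 0 < t) :
    ‖a n * (Real.exp (-((n : ℝ) + 1) ^ 2 * t) : ℂ)‖ ≤
      ((n : ℝ) + 1) ^ (2 - 2 * k) * (k ^ k * t ^ (-k)) := by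
  have hn : (0 : ℝ) < (n : ℝ) + 1 := by positivity
  rw [norm_mul, Complex.norm_real, Real.norm_of_nonneg (Real.exp_pos _).le]
  have h1 := exp_neg_le_mul_rpow hk (u := ((n : ℝ) + 1) ^ 2 * t) (by positivity)
  rw [← neg_mul] at h1
  refine (mul_le_mul (ha n) h1 (Real.exp_pos _).le (by positivity)).trans_eq ?_
  rw [Real.mul_rpow (by positivity) ht.le, ← Real.rpow_natCast, ← Real.rpow_mul hn.le,
    sub_eq_add_neg, Real.rpow_add hn]
  push_cast
  ring_nf

theorem summable_norm_mul_exp_neg_sq (ha : ∀ n, ‖a n‖ ≤ ((n : ℝ) + 1) ^ (2 : ℝ)) {t : ℝ}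
    (ht : 0 < t) : Summable fun n ↦ ‖a n * (Real.exp (-((n : ℝ) + 1) ^ 2 * t) : ℂ)‖ := by
  refine Summable.of_nonneg_of_le (fun _ ↦ norm_nonneg _)
    (fun n ↦ norm_mul_exp_neg_sq_le ha two_pos n ht) (Summable.mul_right _ ?_)
  exact summable_nat_add_one_rpow (by norm_num)

theorem continuousOn_tsum_mul_exp_neg_sq (ha : ∀ n, ‖a n‖ ≤ ((n : ℝ) + 1) ^ (2 : ℝ)) :
    ContinuousOn (fun t : ℝ ↦ ∑' n, a n * (Real.exp (-((n : ℝ) + 1) ^ 2 * t) : ℂ)) (Ioi 0) := by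
  intro x hx
  rw [mem_Ioi] at hx
  have h : ContinuousOn (fun t : ℝ ↦ ∑' n, a n * (Real.exp (-((n : ℝ) + 1) ^ 2 * t) : ℂ))
      (Ioi (x / 2)) := by
    refine continuousOn_tsum (fun n ↦ Continuous.continuousOn (by fun_prop))
      (summable_norm_mul_exp_neg_sq ha (half_pos hx)) fun n t ht ↦ ?_
    rw [mem_Ioi] at ht
    rw [norm_mul, norm_mul, Complex.norm_real, Complex.norm_real,
      Real.norm_of_nonneg (Real.exp_pos _).le, Real.norm_of_nonneg (Real.exp_pos _).le,
      neg_mul, neg_mul]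
    gcongr
  exact (h.continuousAt (Ioi_mem_nhds (half_lt_self hx))).continuousWithinAt

theorem exists_norm_tsum_mul_exp_neg_sq_le (ha : ∀ n, ‖a n‖ ≤ ((n : ℝ) + 1) ^ (2 : ℝ)) {k : ℝ}
    (hk : 3 / 2 < k) : ∃ K : ℝ, ∀ t : ℝ, 0 < t →
      ‖∑' n, a n * (Real.exp (-((n : ℝ) + 1) ^ 2 * t) : ℂ)‖ ≤ K * ‖t ^ (-k)‖ := by
  have hs := summable_nat_add_one_rpow (p := 2 - 2 * k) (by linarith)
  refine ⟨(∑' n : ℕ, ((n : ℝ) + 1) ^ (2 - 2 * k)) * k ^ k, fun t ht ↦ ?_⟩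
  rw [Real.norm_of_nonneg (by positivity), mul_assoc, ← tsum_mul_right]
  exact tsum_of_norm_bounded (hs.mul_right _).hasSum
    fun n ↦ norm_mul_exp_neg_sq_le ha (by linarith) n ht

theorem mellinConvergent_tsum_mul_exp_neg_sq (ha : ∀ n, ‖a n‖ ≤ ((n : ℝ) + 1) ^ (2 : ℝ)) {s : ℂ}
    (hs : 3 / 2 < s.re) :
    MellinConvergent (fun t : ℝ ↦ ∑' n, a n * (Real.exp (-((n : ℝ) + 1) ^ 2 * t) : ℂ)) s := by
  have hO : ∀ k : ℝ, 3 / 2 < k → ∀ l : Filter ℝ, Ioi 0 ∈ l →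
      (fun t : ℝ ↦ ∑' n, a n * (Real.exp (-((n : ℝ) + 1) ^ 2 * t) : ℂ)) =O[l]
        fun t ↦ t ^ (-k) := by
    intro k hk l hl
    obtain ⟨K, hK⟩ := exists_norm_tsum_mul_exp_neg_sq_le ha hk
    exact IsBigO.of_bound K (mem_of_superset hl hK)
  obtain ⟨k, hk1, hk2⟩ := exists_between hs
  exact mellinConvergent_of_isBigO_rpow
    ((continuousOn_tsum_mul_exp_neg_sq ha).locallyIntegrableOn measurableSet_Ioi)
    (hO (s.re + 1) (by linarith) _ (Ioi_mem_atTop 0)) (by linarith)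
    (hO k hk1 _ self_mem_nhdsWithin) hk2

theorem hasSum_mellin_tsum_mul_exp_neg_sq (ha : ∀ n, ‖a n‖ ≤ ((n : ℝ) + 1) ^ (2 : ℝ)) {s : ℂ}
    (hs : 3 / 2 < s.re) :
    HasSum (fun n : ℕ ↦ Complex.Gamma s * a n / ((((n : ℝ) + 1) ^ 2 : ℝ) : ℂ) ^ s)
      (mellin (fun t : ℝ ↦ ∑' n, a n * (Real.exp (-((n : ℝ) + 1) ^ 2 * t) : ℂ)) s) := by
  refine hasSum_mellin (fun n ↦ Or.inr (by positivity)) (by linarith)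
    (fun t ht ↦ (summable_norm_mul_exp_neg_sq ha ht).of_norm.hasSum) ?_
  refine Summable.of_nonneg_of_le (fun n ↦ by positivity) (fun n ↦ ?_)
    (summable_nat_add_one_rpow (p := 2 - 2 * s.re) (by linarith))
  have hn : (0 : ℝ) < (n : ℝ) + 1 := by positivity
  rw [← Real.rpow_two, ← Real.rpow_mul hn.le, Real.rpow_sub hn]
  gcongr
  exact ha n

end squares

/-- The Mellin transform of `∑ σ(n) n ^ (-1 / 2) exp (-n ^ 2 t)`. -/
theorem hasMellin_tsum_sum_divisors {s : ℂ} (hs : 3 / 2 < s.re) :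
    HasMellin (fun t : ℝ ↦ ∑' n : ℕ, ((∑ d ∈ (n + 1 : ℕ).divisors, d : ℕ) : ℂ) /
        ((n + 1 : ℕ) : ℂ) ^ ((1 : ℂ) / 2) * (Real.exp (-((n : ℝ) + 1) ^ 2 * t) : ℂ)) s
      (Complex.Gamma s * riemannZeta (2 * s + 1 / 2) * riemannZeta (2 * s + -1 / 2)) := by
  refine ⟨mellinConvergent_tsum_mul_exp_neg_sq norm_sum_divisors_div_sqrt_le hs, ?_⟩
  refine (hasSum_mellin_tsum_mul_exp_neg_sq norm_sum_divisors_div_sqrt_le hs).unique ?_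
  have h := LSeriesHasSum_sum_divisors (w := 2 * s + 1 / 2) (by simp; linarith)
  unfold LSeriesHasSum at h
  rw [← hasSum_nat_add_iff' 1] at h
  simp only [Finset.range_one, Finset.sum_singleton, LSeries.term_zero, sub_zero] at h
  have h2 := h.mul_left (Complex.Gamma s)
  rw [show 2 * s + 1 / 2 - 1 = 2 * s + -1 / 2 by ring, ← mul_assoc] at h2
  refine h2.congr_fun fun n ↦ ?_
  have hn : ((n + 1 : ℕ) : ℂ) ≠ 0 := by exact_mod_cast n.succ_ne_zero
  rw [LSeries.term_of_ne_zero n.succ_ne_zero, Complex.cpow_add _ _ hn, mul_div_assoc]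
  congr 1
  rw [div_div, mul_comm]
  congr 2
  have h3 : ((((n : ℝ) + 1) ^ 2 : ℝ) : ℂ) = ((n + 1 : ℕ) : ℂ) ^ 2 := by push_cast; rfl
  rw [h3, ← Complex.natCast_cpow_natCast_mul]
  push_cast
  rfl

theorem Complex.tendsto_add_natCast_mul_Gamma (n : ℕ) :
    Tendsto (fun s : ℂ ↦ (s - (-n : ℝ)) * Complex.Gamma s) (𝓝[≠] ((-n : ℝ) : ℂ))
      (𝓝 ((-1) ^ n / n.factorial)) := by
  induction n with
  | zero => simpa using Complex.tendsto_self_mul_Gamma_nhds_zero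
  | succ n ih =>
    have hne : ((-(n + 1 : ℕ) : ℝ) : ℂ) ≠ 0 :=
      Complex.ofReal_ne_zero.2 (neg_ne_zero.2 (Nat.cast_ne_zero.2 n.succ_ne_zero))
    have hshift : Tendsto (fun s : ℂ ↦ s + 1) (𝓝[≠] ((-(n + 1 : ℕ) : ℝ) : ℂ))
        (𝓝[≠] ((-n : ℝ) : ℂ)) := by
      refine tendsto_nhdsWithin_iff.2 ⟨?_, ?_⟩
      · exact (Continuous.tendsto' (by fun_prop) _ _ (by push_cast; ring)).mono_left
          nhdsWithin_le_nhds
      · filter_upwards [self_mem_nhdsWithin] with s hs h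
        refine hs (?_ : s = _)
        rw [eq_sub_of_add_eq (show s + 1 = _ from h)]
        push_cast
        ring
    have hinv : Tendsto (fun s : ℂ ↦ s⁻¹) (𝓝[≠] ((-(n + 1 : ℕ) : ℝ) : ℂ))
        (𝓝 (((-(n + 1 : ℕ) : ℝ) : ℂ))⁻¹) :=
      (continuousAt_inv₀ hne).tendsto.mono_left nhdsWithin_le_nhds
    have h := (ih.comp hshift).mul hinv
    have hval : (-1 : ℂ) ^ n / n.factorial * (((-(n + 1 : ℕ) : ℝ) : ℂ))⁻¹ =
        (-1) ^ (n + 1) / (n + 1).factorial := by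
      rw [Nat.factorial_succ]
      push_cast
      rw [inv_neg, pow_succ]
      field_simp
    rw [hval] at h
    refine h.congr' ?_
    filter_upwards [(continuousAt_id.eventually_ne hne).filter_mono nhdsWithin_le_nhds] with s hs
    have hs : s ≠ 0 := hs
    simp only [Function.comp, Complex.Gamma_add_one s hs]
    push_cast
    field_simp
    ring

theorem tendsto_sub_mul_riemannZeta_two_mul_add {a : ℝ} {b : ℂ} (hab : 2 * (a : ℂ) + b = 1) :
    Tendsto (fun s : ℂ ↦ (s - a) * riemannZeta (2 * s + b)) (𝓝[≠] (a : ℂ)) (𝓝 (1 / 2)) := by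
  have h : Tendsto (fun s : ℂ ↦ 2 * s + b) (𝓝[≠] (a : ℂ)) (𝓝[≠] 1) := by
    refine tendsto_nhdsWithin_iff.2 ⟨?_, ?_⟩
    · exact (Continuous.tendsto' (f := fun s : ℂ ↦ 2 * s + b) (by fun_prop) a 1 hab).mono_left
        nhdsWithin_le_nhds
    · filter_upwards [self_mem_nhdsWithin] with s hs h
      rw [mem_singleton_iff, ← hab, add_left_inj] at h
      exact hs (mul_left_cancel₀ two_ne_zero h)
  have h2 := (riemannZeta_residue_one.comp h).const_mul (1 / 2 : ℂ)
  rw [mul_one] at h2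
  refine h2.congr fun s ↦ ?_
  simp only [Function.comp]
  linear_combination 1 / 2 * riemannZeta (2 * s + b) * hab

/-- The poles of `Γ(s) ζ(2 s + 1 / 2) ζ(2 s - 1 / 2)`. -/
noncomputable def sigmaSqrtPole : ℕ → ℝ
  | 0 => 3 / 4
  | 1 => 1 / 4
  | n + 2 => -n

/-- The residues of `Γ(s) ζ(2 s + 1 / 2) ζ(2 s - 1 / 2)` at its poles. -/
noncomputable def sigmaSqrtResidue : ℕ → ℂ
  | 0 => Complex.Gamma (3 / 4) * riemannZeta 2 * (1 / 2)
  | 1 => Complex.Gamma (1 / 4) * riemannZeta 0 * (1 / 2)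
  | n + 2 => (-1) ^ n / n.factorial *
      (riemannZeta ((1 - 4 * n) / 2) * riemannZeta ((-1 - 4 * n) / 2))

theorem sigmaSqrtPole_lt_one (i : ℕ) : sigmaSqrtPole i < 1 := by
  match i with
  | 0 => norm_num [sigmaSqrtPole]
  | 1 => norm_num [sigmaSqrtPole]
  | n + 2 =>
    simp only [sigmaSqrtPole]
    linarith [n.cast_nonneg (α := ℝ)]

theorem neg_le_sigmaSqrtPole {N i : ℕ} (hi : i < N + 3) : -(N : ℝ) ≤ sigmaSqrtPole i := by
  match i, hi with
  | 0, _ => simp only [sigmaSqrtPole]; linarith [N.cast_nonneg (α := ℝ)]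
  | 1, _ => simp only [sigmaSqrtPole]; linarith [N.cast_nonneg (α := ℝ)]
  | n + 2, h =>
    have : n ≤ N := by omega
    simpa [sigmaSqrtPole]

theorem sigmaSqrtPole_injective : Function.Injective sigmaSqrtPole := by
  have h0 : ∀ n : ℕ, -(n : ℝ) ≤ 0 := fun n ↦ by simp
  intro i j h
  match i, j with
  | 0, 0 => rfl
  | 1, 1 => rfl
  | 0, 1 => norm_num [sigmaSqrtPole] at h
  | 1, 0 => norm_num [sigmaSqrtPole] at h
  | 0, n + 2 => simp only [sigmaSqrtPole] at h; linarith [h0 n]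
  | 1, n + 2 => simp only [sigmaSqrtPole] at h; linarith [h0 n]
  | n + 2, 0 => simp only [sigmaSqrtPole] at h; linarith [h0 n]
  | n + 2, 1 => simp only [sigmaSqrtPole] at h; linarith [h0 n]
  | n + 2, m + 2 => simpa [sigmaSqrtPole] using h

theorem two_mul_ne_one_of_neg_natCast (n : ℕ) :
    2 * ((-n : ℝ) : ℂ) + 1 / 2 ≠ 1 ∧ 2 * ((-n : ℝ) : ℂ) + -1 / 2 ≠ 1 := by
  constructor <;> intro h <;> have h := congrArg Complex.re h <;> norm_num at h <;>
    linarith [n.cast_nonneg (α := ℝ)]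

theorem continuousAt_riemannZeta_two_mul_add {s b : ℂ} (h : 2 * s + b ≠ 1) :
    ContinuousAt (fun s ↦ riemannZeta (2 * s + b)) s :=
  ContinuousAt.comp (g := riemannZeta) (f := fun s ↦ 2 * s + b)
    (differentiableAt_riemannZeta h).continuousAt (by fun_prop)

theorem tendsto_sub_sigmaSqrtPole_mul (i : ℕ) :
    Tendsto (fun s : ℂ ↦ (s - sigmaSqrtPole i) *
      (Complex.Gamma s * riemannZeta (2 * s + 1 / 2) * riemannZeta (2 * s + -1 / 2)))
      (𝓝[≠] (sigmaSqrtPole i : ℂ)) (𝓝 (sigmaSqrtResidue i)) := by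
  have hΓ : ∀ a : ℝ, 0 < a → Tendsto Complex.Gamma (𝓝[≠] (a : ℂ)) (𝓝 (Complex.Gamma a)) := by
    intro a ha
    refine (Complex.differentiableAt_Gamma _ fun m hm ↦ ?_).continuousAt.tendsto.mono_left
      nhdsWithin_le_nhds
    have h := congrArg Complex.re hm
    simp at h
    linarith [m.cast_nonneg (α := ℝ)]
  match i with
  | 0 =>
    have h1 := continuousAt_riemannZeta_two_mul_add (s := ((3 / 4 : ℝ) : ℂ)) (b := 1 / 2)
      (by norm_num)
    have h2 := (((hΓ (3 / 4) (by norm_num)).mul (h1.tendsto.mono_left nhdsWithin_le_nhds)).mul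
      (tendsto_sub_mul_riemannZeta_two_mul_add (a := 3 / 4) (b := -1 / 2) (by norm_num)))
    have e : 2 * ((3 / 4 : ℝ) : ℂ) + 1 / 2 = 2 := by norm_num
    rw [e] at h2
    simp only [sigmaSqrtPole, sigmaSqrtResidue]
    convert h2.congr fun s ↦ ?_ using 2
    · norm_num
    · ring
  | 1 =>
    have h1 := continuousAt_riemannZeta_two_mul_add (s := ((1 / 4 : ℝ) : ℂ)) (b := -1 / 2)
      (by norm_num)
    have h2 := (((hΓ (1 / 4) (by norm_num)).mul (h1.tendsto.mono_left nhdsWithin_le_nhds)).mul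
      (tendsto_sub_mul_riemannZeta_two_mul_add (a := 1 / 4) (b := 1 / 2) (by norm_num)))
    have e : 2 * ((1 / 4 : ℝ) : ℂ) + -1 / 2 = 0 := by norm_num
    rw [e] at h2
    simp only [sigmaSqrtPole, sigmaSqrtResidue]
    convert h2.congr fun s ↦ ?_ using 2
    · norm_num
    · ring
  | n + 2 =>
    have h1 := continuousAt_riemannZeta_two_mul_add (two_mul_ne_one_of_neg_natCast n).1
    have h2 := continuousAt_riemannZeta_two_mul_add (two_mul_ne_one_of_neg_natCast n).2
    have h3 := (Complex.tendsto_add_natCast_mul_Gamma n).mul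
      ((h1.mul h2).tendsto.mono_left nhdsWithin_le_nhds)
    simp only [sigmaSqrtPole, sigmaSqrtResidue]
    convert h3.congr fun s ↦ ?_ using 3
    · congr 2 <;> (push_cast; ring)
    · simp only [Pi.mul_apply]
      ring

theorem differentiableAt_Gamma_mul_riemannZeta_mul {N : ℕ} {s : ℂ} (hs : -(N : ℝ) - 1 < s.re)
    (hne : ∀ i < N + 3, s ≠ sigmaSqrtPole i) :
    DifferentiableAt ℂ (fun s ↦
      Complex.Gamma s * riemannZeta (2 * s + 1 / 2) * riemannZeta (2 * s + -1 / 2)) s := by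
  have hζ : ∀ b : ℂ, 2 * s + b ≠ 1 → DifferentiableAt ℂ (fun s ↦ riemannZeta (2 * s + b)) s :=
    fun b h ↦ DifferentiableAt.comp (g := riemannZeta) (f := fun s ↦ 2 * s + b) s
      (differentiableAt_riemannZeta h) (by fun_prop)
  refine ((Complex.differentiableAt_Gamma s fun m hm ↦ ?_).mul (hζ _ fun h ↦ ?_)).mul
    (hζ _ fun h ↦ ?_)
  · have hmN : m < N + 1 := by
      rw [hm] at hs
      simp at hs
      exact_mod_cast (by linarith : (m : ℝ) < N + 1)
    refine hne (m + 2) (by omega) ?_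
    rw [hm]
    simp [sigmaSqrtPole]
  · refine hne 1 (by omega) ?_
    simp only [sigmaSqrtPole]
    push_cast
    linear_combination h / 2
  · refine hne 0 (by omega) ?_
    simp only [sigmaSqrtPole]
    push_cast
    linear_combination h / 2

theorem exists_norm_Gamma_mul_riemannZeta_mul_le (σ₁ σ₂ : ℝ) : ∃ C : ℝ,
    ∀ s : ℂ, σ₁ ≤ s.re → s.re ≤ σ₂ → 1 ≤ |s.im| →
      ‖Complex.Gamma s * riemannZeta (2 * s + 1 / 2) * riemannZeta (2 * s + -1 / 2)‖ ≤
        C * Real.exp (-(1 / 2) * |s.im|) := by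
  have hπ : (3 / 2 : ℝ) < π / 2 := by linarith [pi_gt_three]
  obtain ⟨A, hA0, hA⟩ := exists_norm_Gamma_le_exp (by norm_num) hπ one_pos σ₁ σ₂
  obtain ⟨B, hB0, hB⟩ := exists_norm_riemannZeta_le_exp (ε := 1 / 4) (by norm_num)
    (2 * σ₁ - 1 / 2) (2 * σ₂ + 1 / 2)
  refine ⟨A * B * B, fun s h1 h2 h3 ↦ ?_⟩
  have hζ : ∀ b : ℝ, |b| ≤ 1 / 2 → ‖riemannZeta (2 * s + b)‖ ≤ B * Real.exp (1 / 2 * |s.im|) := by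
    intro b hb
    have him : |(2 * s + b).im| = 2 * |s.im| := by simp [abs_mul]
    have hre : (2 * s + b).re = 2 * s.re + b := by simp
    have := hB (2 * s + b) (by rw [hre]; linarith [(abs_le.1 hb).1])
      (by rw [hre]; linarith [(abs_le.1 hb).2]) (by rw [him]; linarith)
    rw [him] at this
    exact this.trans_eq (by ring_nf)
  have hζ1 := hζ (1 / 2) (by norm_num [abs_of_pos])
  have hζ2 := hζ (-1 / 2) (by norm_num [abs_div])
  push_cast at hζ1 hζ2
  rw [norm_mul, norm_mul]
  refine (mul_le_mul (mul_le_mul (hA s h1 h2 h3) hζ1 (norm_nonneg _) (by positivity)) hζ2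
    (norm_nonneg _) (by positivity)).trans_eq ?_
  have he : Real.exp (-(1 / 2) * |s.im|) = Real.exp (-(3 / 2) * |s.im|) *
      Real.exp (1 / 2 * |s.im|) * Real.exp (1 / 2 * |s.im|) := by
    rw [← Real.exp_add, ← Real.exp_add]
    ring_nf
  rw [he]
  ring

theorem exists_norm_sigmaSqrt_sub_le (N : ℕ) : ∃ K : ℝ, ∀ x : ℝ, 0 < x →
    ‖(∑' n : ℕ, ((∑ d ∈ (n + 1 : ℕ).divisors, d : ℕ) : ℂ) / ((n + 1 : ℕ) : ℂ) ^ ((1 : ℂ) / 2) *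
        (Real.exp (-((n : ℝ) + 1) ^ 2 * x) : ℂ)) -
      ∑ i ∈ Finset.range (N + 3), sigmaSqrtResidue i *
        ((x : ℂ) ^ (-sigmaSqrtPole i : ℂ) * (Real.exp (-x ^ ((N : ℝ) + 3)) : ℂ))‖ ≤
      K * x ^ ((N : ℝ) + 1 / 2) := by
  have hN : (0 : ℝ) ≤ N := N.cast_nonneg
  obtain ⟨C, hC⟩ := exists_norm_Gamma_mul_riemannZeta_mul_le (-((N : ℝ) + 1 / 2)) 2
  have h := exists_norm_sub_sum_le_of_hasMellin (Finset.range (N + 3))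
    (p := sigmaSqrtPole) sigmaSqrtPole_injective.injOn (c := sigmaSqrtResidue)
    (σ₀ := -((N : ℝ) + 3 / 4)) (L := (N : ℝ) + 3) (by linarith) (by linarith) (by linarith)
    one_half_pos (fun i _ ↦ by linarith [sigmaSqrtPole_lt_one i])
    (fun i hi ↦ by linarith [neg_le_sigmaSqrtPole (Finset.mem_range.1 hi)])
    (fun i _ ↦ by linarith [sigmaSqrtPole_lt_one i])
    (fun s hs hne ↦ differentiableAt_Gamma_mul_riemannZeta_mul (by linarith)
      fun i hi ↦ hne i (Finset.mem_range.2 hi))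
    (fun i _ ↦ tendsto_sub_sigmaSqrtPole_mul i) hC
    (fun s hs ↦ hasMellin_tsum_sum_divisors (by rw [hs]; norm_num))
    (fun x hx ↦ (continuousOn_tsum_mul_exp_neg_sq norm_sum_divisors_div_sqrt_le).continuousAt
      (Ioi_mem_nhds hx))
  simpa only [neg_neg] using h

theorem sum_sigmaSqrtResidue_mul_cpow (N : ℕ) {x : ℝ} (hx : 0 < x) :
    ∑ i ∈ Finset.range (N + 3), sigmaSqrtResidue i * (x : ℂ) ^ (-sigmaSqrtPole i : ℂ) =
      ((π : ℂ) ^ 2 / 9) * Complex.Gamma (7 / 4) * ((x ^ (-(3 : ℝ) / 4) : ℝ) : ℂ) -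
        Complex.Gamma (5 / 4) * ((x ^ (-(1 : ℝ) / 4) : ℝ) : ℂ) +
        ∑ n ∈ Finset.range (N + 1), ((-(x : ℂ)) ^ n / (n.factorial : ℂ)) *
          riemannZeta ((1 - 4 * n) / 2) * riemannZeta ((-1 - 4 * n) / 2) := by
  have h7 : Complex.Gamma (7 / 4) = 3 / 4 * Complex.Gamma (3 / 4) := by
    rw [← Complex.Gamma_add_one _ (by norm_num)]
    norm_num
  have h5 : Complex.Gamma (5 / 4) = 1 / 4 * Complex.Gamma (1 / 4) := by
    rw [← Complex.Gamma_add_one _ (by norm_num)]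
    norm_num
  rw [Finset.sum_range_succ', Finset.sum_range_succ', Complex.ofReal_cpow hx.le,
    Complex.ofReal_cpow hx.le, h7, h5]
  have hsum : ∀ n : ℕ, sigmaSqrtResidue (n + 1 + 1) * (x : ℂ) ^ (-sigmaSqrtPole (n + 1 + 1) : ℂ) =
      ((-(x : ℂ)) ^ n / (n.factorial : ℂ)) *
          riemannZeta ((1 - 4 * n) / 2) * riemannZeta ((-1 - 4 * n) / 2) := by
    intro n
    simp only [sigmaSqrtPole, sigmaSqrtResidue]
    rw [← Complex.ofReal_neg, neg_neg, Complex.ofReal_natCast, Complex.cpow_natCast, neg_pow]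
    ring
  simp_rw [hsum]
  simp only [sigmaSqrtPole, sigmaSqrtResidue, riemannZeta_two, riemannZeta_zero]
  push_cast
  ring_nf

theorem isLittleO_rpow_pow {q : ℝ} {N : ℕ} (h : N < q) :
    (fun x : ℝ ↦ x ^ q) =o[𝓝[>] 0] fun x ↦ x ^ N := by
  refine (isLittleO_iff_tendsto' ?_).2 ?_
  · filter_upwards [self_mem_nhdsWithin] with x hx h0
    exact absurd h0 (pow_pos hx N).ne'
  · have h1 : Tendsto (fun x : ℝ ↦ x ^ (q - N)) (𝓝[>] 0) (𝓝 0) := by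
      have h2 := (Real.continuousAt_rpow_const 0 (q - N) (Or.inr (sub_pos.2 h).le)).tendsto
      rw [Real.zero_rpow (sub_pos.2 h).ne'] at h2
      exact h2.mono_left nhdsWithin_le_nhds
    refine h1.congr' ?_
    filter_upwards [self_mem_nhdsWithin] with x hx
    rw [Real.rpow_sub hx, Real.rpow_natCast]

theorem isLittleO_cpow_mul_exp_neg_rpow_sub_one {p L : ℝ} {N : ℕ} (c : ℂ) (h : N < L - p) :
    (fun x : ℝ ↦ c * ((x : ℂ) ^ (-p : ℂ) * (Real.exp (-x ^ L) : ℂ)) - c * (x : ℂ) ^ (-p : ℂ))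
      =o[𝓝[>] 0] fun x ↦ x ^ N := by
  refine IsBigO.trans_isLittleO (IsBigO.of_bound ‖c‖ ?_) (isLittleO_rpow_pow h)
  filter_upwards [self_mem_nhdsWithin] with x hx
  have hx : 0 < x := hx
  have h1 : ‖(Real.exp (-x ^ L) : ℂ) - 1‖ ≤ x ^ L := by
    rw [← Complex.ofReal_one, ← Complex.ofReal_sub, Complex.norm_real, Real.norm_eq_abs,
      abs_sub_comm, abs_of_nonneg (sub_nonneg.2 (Real.exp_le_one_iff.2 (by
        simpa using Real.rpow_nonneg hx.le L)))]
    linarith [Real.add_one_le_exp (-x ^ L)]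
  rw [← mul_sub, ← mul_sub_one, norm_mul, norm_mul, Complex.norm_cpow_eq_rpow_re_of_pos hx,
    Real.norm_of_nonneg (Real.rpow_nonneg hx.le _), show L - p = -p + L by ring, Real.rpow_add hx]
  have hre : (-p : ℂ).re = -p := by simp
  rw [hre]
  gcongr

end MellinExpansion

/-- asymptotics of `∑_{n≥1} σ(n) e^{-n² x}/√n` as `x → 0⁺`. -/
theorem sum_sigma_one_sqrt_asymp (N : ℕ) :
    (fun x : ℝ =>
      (∑' n : ℕ, ((∑ d ∈ (n + 1 : ℕ).divisors, d : ℕ) : ℂ) /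
          ((n + 1 : ℕ) : ℂ) ^ ((1 : ℂ) / 2) *
        Complex.exp (-((((n + 1 : ℕ) : ℝ) ^ 2 * x : ℝ) : ℂ))) -
      (((π : ℂ) ^ 2 / 9) * Complex.Gamma (7 / 4) * ((x ^ (-(3 : ℝ) / 4) : ℝ) : ℂ) -
        Complex.Gamma (5 / 4) * ((x ^ (-(1 : ℝ) / 4) : ℝ) : ℂ) +
        ∑ n ∈ Finset.range (N + 1), ((-(x : ℂ)) ^ n / (n.factorial : ℂ)) *
          riemannZeta ((1 - 4 * n) / 2) * riemannZeta ((-1 - 4 * n) / 2)))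
      =o[nhdsWithin 0 (Set.Ioi 0)]
    fun x : ℝ => x ^ N := by
  obtain ⟨K, hK⟩ := exists_norm_sigmaSqrt_sub_le N
  have hO := (IsBigO.of_bound K (mem_of_superset self_mem_nhdsWithin fun x (hx : x ∈ Set.Ioi 0) ↦
    (hK x hx).trans_eq (by rw [Real.norm_of_nonneg (Real.rpow_nonneg (le_of_lt hx) _)]))
    ).trans_isLittleO (isLittleO_rpow_pow (q := (N : ℝ) + 1 / 2) (N := N) (by linarith))
  have hP := IsLittleO.sum (s := Finset.range (N + 3)) fun i _ ↦
    isLittleO_cpow_mul_exp_neg_rpow_sub_one (p := sigmaSqrtPole i) (L := (N : ℝ) + 3) (N := N)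
      (sigmaSqrtResidue i) (by linarith [sigmaSqrtPole_lt_one i])
  refine (hO.add hP).congr' ?_ EventuallyEq.rfl
  filter_upwards [self_mem_nhdsWithin] with x hx
  rw [Finset.sum_apply, Finset.sum_sub_distrib, sum_sigmaSqrtResidue_mul_cpow N hx,
    sub_add_sub_cancel]
  congr 2
  funext n
  push_cast
  rw [neg_mul]
end

section
/- For every natural number $N$, as $x \to 0^+$: $\sum_{n=1}^{\infty} \frac{\sigma(n)}{n} e^{-n^2 x} = \frac{\pi^{5/2}}{12\sqrt{x}} + \frac{\log x}{4} - \log\sqrt{2\pi} - \frac{\gamma}{4} + o(x^N)$. -/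
open Real Filter Asymptotics

/-- The Dirichlet coefficient `σ(n) / n`. -/
noncomputable def sigmaRatio (n : ℕ) : ℝ :=
  (ArithmeticFunction.sigma 1 n : ℝ) / n

/-- The series `∑ σ(n) / n · e^{2πinτ}`, which is `-log ∏ (1 - e^{2πinτ})`. -/
noncomputable def sigmaRatioSeries (τ : ℂ) : ℂ :=
  ∑' n : ℕ, (sigmaRatio n : ℂ) * Complex.exp (2 * π * Complex.I * n * τ)

lemma sigma_one_le_sq (n : ℕ) : ArithmeticFunction.sigma 1 n ≤ n ^ 2 := by
  rw [ArithmeticFunction.sigma_one_apply, pow_two]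
  calc ∑ d ∈ n.divisors, d ≤ ∑ _d ∈ n.divisors, n := Finset.sum_le_sum fun d hd ↦ Nat.divisor_le hd
    _ = n.divisors.card * n := by simp
    _ ≤ n * n := Nat.mul_le_mul_right _ (Nat.card_divisors_le_self n)

lemma sigmaRatio_nonneg (n : ℕ) : 0 ≤ sigmaRatio n := by
  unfold sigmaRatio; positivity

lemma sigmaRatio_le (n : ℕ) : sigmaRatio n ≤ n := by
  have h : (ArithmeticFunction.sigma 1 n : ℝ) ≤ (n : ℝ) ^ 2 := mod_cast sigma_one_le_sq n
  unfold sigmaRatio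
  exact div_le_of_le_mul₀ n.cast_nonneg n.cast_nonneg (by linarith [pow_two (n : ℝ)])

lemma sigmaRatio_mul_self (n : ℕ) :
    sigmaRatio n * n = (ArithmeticFunction.sigma 1 n : ℝ) := by
  rcases eq_or_ne n 0 with rfl | hn
  · simp
  · unfold sigmaRatio; field_simp

lemma norm_exp_two_pi_I_nat_mul (n : ℕ) (τ : ℂ) :
    ‖Complex.exp (2 * π * Complex.I * n * τ)‖ = Real.exp (-(2 * π * τ.im) * n) := by
  rw [Complex.norm_exp]
  congr 1
  simp [Complex.mul_re, Complex.mul_im]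
  ring

lemma norm_sigmaRatio_mul_exp_le (n : ℕ) (τ : ℂ) :
    ‖(sigmaRatio n : ℂ) * Complex.exp (2 * π * Complex.I * n * τ)‖ ≤
      n * Real.exp (-(2 * π * τ.im) * n) := by
  rw [norm_mul, norm_exp_two_pi_I_nat_mul, Complex.norm_real, Real.norm_eq_abs,
    abs_of_nonneg (sigmaRatio_nonneg n)]
  gcongr
  exact sigmaRatio_le n

lemma summable_nat_pow_mul_exp (k : ℕ) {c : ℝ} (hc : 0 < c) :
    Summable fun n : ℕ ↦ (n : ℝ) ^ k * Real.exp (-(2 * π * c) * n) := by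
  simpa [neg_mul, mul_comm, mul_left_comm] using
    Real.summable_pow_mul_exp_neg_nat_mul k (show 0 < 2 * π * c by positivity)

lemma summable_sigmaRatioSeries {τ : ℂ} (hτ : 0 < τ.im) :
    Summable fun n : ℕ ↦ (sigmaRatio n : ℂ) * Complex.exp (2 * π * Complex.I * n * τ) :=
  .of_norm_bounded (by simpa using summable_nat_pow_mul_exp 1 hτ)
    fun n ↦ norm_sigmaRatio_mul_exp_le n τ

lemma hasDerivAt_sigmaRatioSeries (z : UpperHalfPlane) :
    HasDerivAt sigmaRatioSeries (π * Complex.I / 12 * (1 - EisensteinSeries.E2 z)) z := by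
  have hz := z.im_pos
  have hE : ∑' n : ℕ, 2 * π * Complex.I * ((ArithmeticFunction.sigma 1 n : ℂ) *
      Complex.exp (2 * π * Complex.I * n * z)) =
      π * Complex.I / 12 * (1 - EisensteinSeries.E2 z) := by
    refine HasSum.tsum_eq ?_
    convert! ((hasSum_ite_eq 0 (1 : ℂ)).sub
      (EisensteinSeries.hasSum_qExpansion_E2 (z := z))).mul_left (π * Complex.I / 12) using 2 with n
    have : Complex.exp (2 * π * Complex.I * n * z) =
        Complex.exp (2 * π * Complex.I * z) ^ n := by
      rw [← Complex.exp_nat_mul]; ring_nf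
    rw [this]
    split_ifs with hn
    · simp [hn]
    · simp only [smul_eq_mul]; ring
  rw [← hE]
  refine hasDerivAt_tsum_of_isPreconnected (t := {w : ℂ | z.im / 2 < w.im})
    (y₀ := (z : ℂ)) (y := (z : ℂ))
    ((summable_nat_pow_mul_exp 2 (half_pos hz)).mul_left (2 * π))
    (isOpen_lt continuous_const Complex.continuous_im)
    (convex_halfSpace_im_gt _).isPreconnected
    (g := fun n w ↦ (sigmaRatio n : ℂ) * Complex.exp (2 * π * Complex.I * n * w))
    (g' := fun n w ↦ 2 * π * Complex.I * ((ArithmeticFunction.sigma 1 n : ℂ) *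
      Complex.exp (2 * π * Complex.I * n * w)))
    (fun n w _ ↦ ?_) (fun n w hw ↦ ?_)
    (by simpa using hz) (summable_sigmaRatioSeries hz) (by simpa using hz)
  · have h := (((hasDerivAt_id w).const_mul (2 * π * Complex.I * n)).cexp).const_mul
      (sigmaRatio n : ℂ)
    refine h.congr_deriv ?_
    have : (ArithmeticFunction.sigma 1 n : ℂ) = sigmaRatio n * n :=
      mod_cast (sigmaRatio_mul_self n).symm
    simp only [this, id]
    ring
  · have hs : ((ArithmeticFunction.sigma 1 n : ℕ) : ℝ) ≤ (n : ℝ) ^ 2 := mod_cast sigma_one_le_sq n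
    have h2 : ‖(2 * π * Complex.I : ℂ)‖ = 2 * π := by
      simp [abs_of_pos pi_pos]
    rw [norm_mul, h2, norm_mul, norm_exp_two_pi_I_nat_mul, Complex.norm_natCast]
    have hw' : z.im / 2 < w.im := hw
    gcongr

lemma E2_neg_inv (z : UpperHalfPlane) :
    EisensteinSeries.E2 (UpperHalfPlane.mk (-(z : ℂ))⁻¹ z.im_inv_neg_coe_pos) * ((z : ℂ) ^ 2)⁻¹ =
      EisensteinSeries.E2 z + 6 / (π * Complex.I * z) := by
  have h := congrFun (EisensteinSeries.E2_slash_action ModularGroup.S) z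
  have hz := z.ne_zero
  simp only [one_div, ModularForm.SL_slash_def, UpperHalfPlane.modular_S_smul, ModularGroup.denom_S,
    Int.reduceNeg, zpow_neg, riemannZeta_two, mul_inv_rev, inv_div, Pi.sub_apply, Pi.smul_apply,
    EisensteinSeries.D2, smul_eq_mul, show ModularGroup.S 1 0 = 1 by simp [ModularGroup.S]] at h
  rw [zpow_ofNat] at h
  rw [h]
  have hpi : (π : ℂ) ≠ 0 := mod_cast pi_ne_zero
  field_simp
  push_cast
  linear_combination (-6 : ℂ) * Complex.I_sq

/-- The logarithmic form of the transformation law of the Dedekind eta function. -/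
lemma sigmaRatioSeries_eq {τ : ℂ} (hτ : 0 < τ.im) :
    sigmaRatioSeries τ = π * Complex.I / 12 * (τ + τ⁻¹) + Complex.log (-Complex.I * τ) / 2 +
      sigmaRatioSeries (-τ)⁻¹ := by
  let D : ℂ → ℂ := fun τ ↦ sigmaRatioSeries τ - (π * Complex.I / 12 * (τ + τ⁻¹) +
    Complex.log (-Complex.I * τ) / 2 + sigmaRatioSeries (-τ)⁻¹)
  have hD (w : ℂ) (hw : w ∈ UpperHalfPlane.upperHalfPlaneSet) : HasDerivAt D 0 w := by
    have hw : 0 < w.im := hw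
    have hw0 : w ≠ 0 := by rintro rfl; simp at hw
    let z : UpperHalfPlane := ⟨w, hw⟩
    have h1 := hasDerivAt_sigmaRatioSeries z
    have h2 := hasDerivAt_sigmaRatioSeries (UpperHalfPlane.mk (-(z : ℂ))⁻¹ z.im_inv_neg_coe_pos)
    have h3 : HasDerivAt (fun τ : ℂ ↦ (-τ)⁻¹) ((w ^ 2)⁻¹) w := by
      refine ((hasDerivAt_neg w).inv (neg_ne_zero.2 hw0)).congr_deriv ?_
      simp
    have h4 : HasDerivAt (fun τ : ℂ ↦ sigmaRatioSeries (-τ)⁻¹) _ w :=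
      HasDerivAt.comp (h₂ := sigmaRatioSeries) w h2 h3
    have h5 : HasDerivAt (fun τ : ℂ ↦ Complex.log (-Complex.I * τ)) (w⁻¹) w := by
      refine (((hasDerivAt_id w).const_mul (-Complex.I)).clog
        (Or.inl (by simpa using hw))).congr_deriv ?_
      simp only [id]
      have := Complex.I_ne_zero
      field_simp
    have h6 := h1.sub (((((hasDerivAt_id w).add (hasDerivAt_inv hw0)).const_mul
      (π * Complex.I / 12)).add (h5.div_const 2)).add h4)
    refine h6.congr_deriv ?_
    have hE := E2_neg_inv z
    have hpi : (π : ℂ) ≠ 0 := mod_cast pi_ne_zero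
    have : (π * Complex.I / 12) * (6 / (π * Complex.I * w)) = w⁻¹ / 2 := by
      have := Complex.I_ne_zero
      field_simp
      norm_num
    change EisensteinSeries.E2 _ * (w ^ 2)⁻¹ = EisensteinSeries.E2 z + 6 / (π * Complex.I * w) at hE
    linear_combination (π * Complex.I / 12) * hE + this
  have hconst := UpperHalfPlane.isOpen_upperHalfPlaneSet.is_const_of_deriv_eq_zero
    (convex_halfSpace_im_gt 0).isPreconnected
    (fun w hw ↦ (hD w hw).differentiableAt.differentiableWithinAt) (fun w hw ↦ (hD w hw).deriv)
    (show τ ∈ UpperHalfPlane.upperHalfPlaneSet from hτ)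
    (show Complex.I ∈ UpperHalfPlane.upperHalfPlaneSet by simp)
  have hI : D Complex.I = 0 := by
    simp [D]
  exact sub_eq_zero.1 (hconst.trans hI)

section

open MeasureTheory

lemma hasDerivAt_integral_rpow_mul_cexp {s : ℝ} (hs : 0 < s) {r : ℂ} (hr : 0 < r.re) :
    HasDerivAt (fun r : ℂ ↦ ∫ t in Set.Ioi (0 : ℝ), ((t ^ (s - 1) : ℝ) : ℂ) * Complex.exp (-(r * t)))
      (∫ t in Set.Ioi (0 : ℝ), ((t ^ (s - 1) : ℝ) : ℂ) * (Complex.exp (-(r * t)) * (-t))) r := by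
  have hmeas (f : ℝ → ℂ) (hf : Continuous f) : AEStronglyMeasurable
      (fun t : ℝ ↦ ((t ^ (s - 1) : ℝ) : ℂ) * f t) (volume.restrict (Set.Ioi 0)) := by
    have : Measurable fun t : ℝ ↦ ((t ^ (s - 1) : ℝ) : ℂ) := by fun_prop
    exact (this.mul hf.measurable).aestronglyMeasurable
  have hint {q : ℝ} (hq : -1 < q) {b : ℝ} (hb : 0 < b) :
      IntegrableOn (fun t : ℝ ↦ t ^ q * Real.exp (-b * t)) (Set.Ioi 0) := by
    simpa using integrableOn_rpow_mul_exp_neg_mul_rpow hq one_pos hb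
  have hnorm (z : ℂ) {t : ℝ} (ht : 0 < t) :
      ‖((t ^ (s - 1) : ℝ) : ℂ) * Complex.exp (-(z * t))‖ = t ^ (s - 1) * Real.exp (-z.re * t) := by
    rw [norm_mul, Complex.norm_exp, Complex.norm_real, Real.norm_of_nonneg (by positivity)]
    simp
  refine (hasDerivAt_integral_of_dominated_loc_of_deriv_le (𝕜 := ℂ) (x₀ := r)
    (F := fun z t ↦ ((t ^ (s - 1) : ℝ) : ℂ) * Complex.exp (-(z * t)))
    (F' := fun z t ↦ ((t ^ (s - 1) : ℝ) : ℂ) * (Complex.exp (-(z * t)) * (-t)))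
    (s := {z : ℂ | r.re / 2 < z.re})
    (bound := fun t ↦ t ^ s * Real.exp (-(r.re / 2) * t))
    ((isOpen_lt continuous_const Complex.continuous_re).mem_nhds (by simpa using hr))
    (.of_forall fun z ↦ hmeas _ (by fun_prop)) ?_ (hmeas _ (by fun_prop)) ?_
    (hint (by linarith) (half_pos hr)) ?_).2
  · refine (hint (by linarith : -1 < s - 1) hr).mono' (hmeas _ (by fun_prop)) ?_
    filter_upwards [ae_restrict_mem measurableSet_Ioi] with t ht
    exact (hnorm r ht).le
  · filter_upwards [ae_restrict_mem measurableSet_Ioi] with t (ht : 0 < t) z (hz : r.re / 2 < z.re)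
    rw [← mul_assoc, norm_mul, hnorm z ht, norm_neg, Complex.norm_real, Real.norm_of_nonneg ht.le,
      mul_right_comm, ← Real.rpow_add_one ht.ne', sub_add_cancel]
    gcongr
  · refine .of_forall fun t z _ ↦ ?_
    have h := (((hasDerivAt_id z).mul_const (t : ℂ)).neg.cexp).const_mul ((t ^ (s - 1) : ℝ) : ℂ)
    refine h.congr_deriv ?_
    simp

/-- The Laplace transform of a power, at a complex parameter. -/
lemma integral_rpow_mul_cexp_neg_mul {s : ℝ} (hs : 0 < s) {r : ℂ} (hr : 0 < r.re) :
    ∫ t in Set.Ioi (0 : ℝ), ((t ^ (s - 1) : ℝ) : ℂ) * Complex.exp (-(r * t)) =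
      r ^ (-s : ℂ) * Real.Gamma s := by
  have hopen : IsOpen {z : ℂ | 0 < z.re} := isOpen_lt continuous_const Complex.continuous_re
  have hf : AnalyticOnNhd ℂ (fun r : ℂ ↦ ∫ t in Set.Ioi (0 : ℝ),
      ((t ^ (s - 1) : ℝ) : ℂ) * Complex.exp (-(r * t))) {z : ℂ | 0 < z.re} :=
    DifferentiableOn.analyticOnNhd (fun z hz ↦
      (hasDerivAt_integral_rpow_mul_cexp hs hz).differentiableAt.differentiableWithinAt) hopen
  have hg : AnalyticOnNhd ℂ (fun r : ℂ ↦ r ^ (-s : ℂ) * (Real.Gamma s : ℂ)) {z : ℂ | 0 < z.re} :=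
    DifferentiableOn.analyticOnNhd (fun z hz ↦
      ((differentiableAt_id.cpow_const (Or.inl hz)).mul_const _).differentiableWithinAt) hopen
  have hpos : ∀ᶠ x : ℝ in nhdsWithin 1 {1}ᶜ, 0 < x :=
    nhdsWithin_le_nhds (lt_mem_nhds one_pos)
  have htend : Tendsto (fun x : ℝ ↦ (x : ℂ)) (nhdsWithin 1 {1}ᶜ) (nhdsWithin 1 {1}ᶜ) := by
    refine tendsto_nhdsWithin_iff.2 ⟨?_, ?_⟩
    · exact (Complex.continuous_ofReal.tendsto' 1 1 (by simp)).mono_left nhdsWithin_le_nhds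
    · filter_upwards [self_mem_nhdsWithin] with x hx
      simpa using hx
  refine hf.eqOn_of_preconnected_of_frequently_eq hg (convex_halfSpace_re_gt 0).isPreconnected
    (z₀ := 1) (by simp) (htend.frequently (hpos.mono fun x hx ↦ ?_).frequently) hr
  have h := Complex.integral_cpow_mul_exp_neg_mul_Ioi (a := s) (by simpa using hs) hx
  rw [Complex.Gamma_ofReal] at h
  rw [Complex.cpow_neg, ← Complex.inv_cpow _ _
    (by simp [Complex.arg_ofReal_of_nonneg hx.le, pi_ne_zero.symm]), ← one_div, ← h]
  refine setIntegral_congr_fun measurableSet_Ioi fun t ht ↦ ?_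
  simp [Complex.ofReal_cpow (le_of_lt ht)]

/-- A parametrization of the line `re = 1`. -/
noncomputable def reOneLine (u : ℝ) : ℂ := 1 - u * Complex.I

lemma reOneLine_re (u : ℝ) : (reOneLine u).re = 1 := by simp [reOneLine]

lemma reOneLine_ne_zero (u : ℝ) : reOneLine u ≠ 0 := by
  intro h
  simpa [h] using reOneLine_re u

lemma sq_norm_reOneLine (u : ℝ) : ‖reOneLine u‖ ^ 2 = 1 + u ^ 2 := by
  rw [← Complex.normSq_eq_norm_sq, Complex.normSq_apply]
  simp [reOneLine]
  ring

lemma one_le_norm_reOneLine (u : ℝ) : 1 ≤ ‖reOneLine u‖ := by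
  have := Complex.abs_re_le_norm (reOneLine u)
  rwa [reOneLine_re, abs_one] at this

lemma norm_reOneLine_le (u : ℝ) : ‖reOneLine u‖ ≤ 1 + u ^ 2 := by
  rw [← sq_norm_reOneLine]
  exact le_self_pow₀ (one_le_norm_reOneLine u) two_ne_zero

@[fun_prop]
lemma continuous_reOneLine : Continuous reOneLine := by
  unfold reOneLine; fun_prop

lemma norm_log_reOneLine_le (u : ℝ) : ‖Complex.log (reOneLine u)‖ ≤ (1 + π) * (1 + u ^ 2) := by
  have h1 := one_le_norm_reOneLine u
  have h2 := norm_reOneLine_le u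
  have h3 := Complex.norm_le_abs_re_add_abs_im (Complex.log (reOneLine u))
  rw [Complex.log_re, Complex.log_im, abs_of_nonneg (Real.log_nonneg h1)] at h3
  have h4 := Complex.abs_arg_le_pi (reOneLine u)
  have h5 := Real.log_le_self (norm_nonneg (reOneLine u))
  nlinarith [pi_pos, sq_nonneg u]

/-- The Gaussian weight `e^{v²/4}` along the line `re v = 1`. -/
noncomputable def gaussianWeight (u : ℝ) : ℂ := Complex.exp (reOneLine u ^ 2 / 4)

@[fun_prop]
lemma continuous_gaussianWeight : Continuous gaussianWeight := by
  unfold gaussianWeight; fun_prop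

lemma norm_gaussianWeight (u : ℝ) : ‖gaussianWeight u‖ = Real.exp (1 / 4 - u ^ 2 / 4) := by
  rw [gaussianWeight, Complex.norm_exp]
  congr 1
  simp [reOneLine, pow_two]
  ring

lemma integrable_norm_gaussianWeight_mul_pow (k : ℕ) :
    Integrable fun u ↦ ‖gaussianWeight u‖ * (1 + u ^ 2) ^ k := by
  have h := (integrable_exp_neg_mul_sq (b := 1 / 8) (by norm_num)).const_mul
    (k.factorial * 8 ^ k * Real.exp (3 / 8))
  refine h.mono' (by fun_prop) (.of_forall fun u ↦ ?_)
  rw [Real.norm_of_nonneg (by positivity), norm_gaussianWeight]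
  have h1 := Real.pow_div_factorial_le_exp (x := (1 + u ^ 2) / 8) (by positivity) k
  rw [div_pow, div_div, div_le_iff₀ (by positivity)] at h1
  calc Real.exp (1 / 4 - u ^ 2 / 4) * (1 + u ^ 2) ^ k
      ≤ Real.exp (1 / 4 - u ^ 2 / 4) * (Real.exp ((1 + u ^ 2) / 8) * (8 ^ k * k.factorial)) := by
        gcongr
    _ = k.factorial * 8 ^ k * (Real.exp (1 / 4 - u ^ 2 / 4) * Real.exp ((1 + u ^ 2) / 8)) := by ring
    _ = k.factorial * 8 ^ k * (Real.exp (3 / 8) * Real.exp (-(1 / 8) * u ^ 2)) := by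
        rw [← Real.exp_add, ← Real.exp_add]; ring_nf
    _ = _ := by ring

lemma integrable_gaussianWeight_mul {f : ℝ → ℂ} (hf : AEStronglyMeasurable f volume) {C : ℝ} {k : ℕ}
    (hC : ∀ u, ‖f u‖ ≤ C * (1 + u ^ 2) ^ k) : Integrable fun u ↦ gaussianWeight u * f u := by
  refine ((integrable_norm_gaussianWeight_mul_pow k).const_mul C).mono' ?_ (.of_forall fun u ↦ ?_)
  · exact continuous_gaussianWeight.aestronglyMeasurable.mul hf
  · rw [norm_mul, mul_left_comm]
    exact mul_le_mul_of_nonneg_left (hC u) (norm_nonneg _)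

lemma integral_gaussianWeight_mul_exp (t : ℝ) :
    ∫ u, gaussianWeight u * Complex.exp (-(reOneLine u * t)) =
      2 * (√π : ℝ) * (Real.exp (-t ^ 2) : ℝ) := by
  have h := integral_cexp_quadratic (b := -1 / 4) (by norm_num) (Complex.I * t - Complex.I / 2)
    (1 / 4 - t)
  have hs : (π / -(-1 / 4) : ℂ) ^ (1 / 2 : ℂ) = 2 * (√π : ℝ) := by
    have h4 : (π / -(-1 / 4) : ℂ) = ((2 ^ 2 * π : ℝ) : ℂ) := by push_cast; ring
    have h2 : (1 / 2 : ℂ) = ((1 / 2 : ℝ) : ℂ) := by norm_num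
    rw [h4, h2, ← Complex.ofReal_cpow (by positivity), ← Real.sqrt_eq_rpow,
      Real.sqrt_mul (by norm_num), Real.sqrt_sq (by norm_num)]
    norm_num
  rw [hs] at h
  convert h using 2
  · ext u
    rw [gaussianWeight, ← Complex.exp_add]
    congr 1
    simp only [reOneLine]
    ring_nf
    rw [Complex.I_sq]
    ring
  · push_cast
    congr 1
    ring_nf
    rw [Complex.I_sq]
    ring

lemma integral_gaussianWeight : ∫ u, gaussianWeight u = 2 * (√π : ℝ) := by
  simpa using integral_gaussianWeight_mul_exp 0

lemma integral_gaussianWeight_mul_reOneLine : ∫ u, gaussianWeight u * reOneLine u = 0 := by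
  refine integral_eq_zero_of_hasDerivAt_of_integrable
    (f := fun u ↦ gaussianWeight u * (2 * Complex.I)) (fun u ↦ ?_) ?_ ?_
  · have h1 : HasDerivAt reOneLine (-Complex.I) u := by
      have h : HasDerivAt reOneLine _ u :=
        ((hasDerivAt_id u).ofReal_comp.mul_const Complex.I).const_sub 1
      exact h.congr_deriv (by simp)
    have h2 : HasDerivAt gaussianWeight _ u := ((h1.pow 2).div_const 4).cexp
    refine (h2.mul_const (2 * Complex.I)).congr_deriv ?_
    simp only [gaussianWeight, Pi.pow_apply]
    push_cast
    linear_combination (-reOneLine u * Complex.exp (reOneLine u ^ 2 / 4)) * Complex.I_sq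
  · exact integrable_gaussianWeight_mul (by fun_prop) (C := 1) (k := 1)
      fun u ↦ by simpa using norm_reOneLine_le u
  · exact integrable_gaussianWeight_mul (by fun_prop) (C := 2) (k := 0) fun u ↦ by simp

lemma integral_gaussianWeight_mul_cpow {s : ℝ} (hs : 0 < s) :
    ∫ u, gaussianWeight u * reOneLine u ^ (-s : ℂ) =
      (√π * Real.Gamma (s / 2) / Real.Gamma s : ℝ) := by
  have hG := (Real.Gamma_pos_of_pos hs).ne'
  have hGc : (Real.Gamma s : ℂ) ≠ 0 := mod_cast hG
  have key : (∫ u, gaussianWeight u * reOneLine u ^ (-s : ℂ)) * Real.Gamma s =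
      (√π * Real.Gamma (s / 2) : ℝ) := by
    calc (∫ u, gaussianWeight u * reOneLine u ^ (-s : ℂ)) * Real.Gamma s
        = ∫ u, ∫ t in Set.Ioi (0 : ℝ), gaussianWeight u *
            (((t ^ (s - 1) : ℝ) : ℂ) * Complex.exp (-(reOneLine u * t))) := by
          rw [← integral_mul_const]
          congr with u
          rw [integral_const_mul, integral_rpow_mul_cexp_neg_mul hs (by simp [reOneLine_re])]
          ring
      _ = ∫ t in Set.Ioi (0 : ℝ), ∫ u, gaussianWeight u *
            (((t ^ (s - 1) : ℝ) : ℂ) * Complex.exp (-(reOneLine u * t))) := by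
          refine integral_integral_swap ?_
          have h1 : Integrable fun u ↦ ‖gaussianWeight u‖ := by
            simpa using integrable_norm_gaussianWeight_mul_pow 0
          have h2 : IntegrableOn (fun t : ℝ ↦ t ^ (s - 1) * Real.exp (-1 * t)) (Set.Ioi 0) := by
            simpa using integrableOn_rpow_mul_exp_neg_mul_rpow (by linarith : -1 < s - 1) one_pos one_pos
          refine (h1.mul_prod h2).mono' ?_ ?_
          · refine Measurable.aestronglyMeasurable ?_
            have : Measurable reOneLine := continuous_reOneLine.measurable
            have : Measurable gaussianWeight := continuous_gaussianWeight.measurable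
            unfold Function.uncurry
            fun_prop
          · have : ∀ᵐ p : ℝ × ℝ ∂(volume.prod (volume.restrict (Set.Ioi 0))), 0 < p.2 :=
              Measure.quasiMeasurePreserving_snd.ae (ae_restrict_mem measurableSet_Ioi)
            filter_upwards [this] with p hp
            simp only [Function.uncurry]
            rw [norm_mul, norm_mul, Complex.norm_exp, Complex.norm_real,
              Real.norm_of_nonneg (by positivity)]
            simp [reOneLine_re]
      _ = ∫ t in Set.Ioi (0 : ℝ), ((2 * √π * (t ^ (s - 1) * Real.exp (-t ^ (2 : ℝ))) : ℝ) : ℂ) := by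
          congr with t
          simp_rw [mul_left_comm (gaussianWeight _)]
          rw [integral_const_mul, integral_gaussianWeight_mul_exp, Real.rpow_two]
          push_cast
          ring
      _ = _ := by
          rw [integral_complex_ofReal, integral_const_mul,
            integral_rpow_mul_exp_neg_rpow two_pos (by linarith)]
          congr 1
          rw [sub_add_cancel]
          ring
  rw [eq_comm, Complex.ofReal_div, div_eq_iff hGc, key]

lemma integral_gaussianWeight_div_reOneLine :
    ∫ u, gaussianWeight u * (reOneLine u)⁻¹ = (π : ℝ) := by
  have h := integral_gaussianWeight_mul_cpow one_pos
  simpa [Complex.cpow_neg, Real.Gamma_one_half_eq, -one_div, Real.mul_self_sqrt pi_pos.le] using h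


lemma hasDerivAt_integral_gaussianWeight_mul_cpow :
    HasDerivAt (fun s : ℝ ↦ ∫ u, gaussianWeight u * reOneLine u ^ (-s : ℂ))
      (-∫ u, gaussianWeight u * Complex.log (reOneLine u)) 0 := by
  have hslit (u : ℝ) : reOneLine u ∈ Complex.slitPlane := Or.inl (by simp [reOneLine_re])
  have hpow (s : ℝ) : Continuous fun u ↦ reOneLine u ^ (-s : ℂ) :=

    continuous_reOneLine.cpow continuous_const hslit
  have hlog : Continuous fun u ↦ Complex.log (reOneLine u) := continuous_reOneLine.clog hslit
  have hnorm {s : ℝ} (hs : -1 < s) (u : ℝ) : ‖reOneLine u ^ (-s : ℂ)‖ ≤ 1 + u ^ 2 := by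
    rw [← Complex.ofReal_neg, Complex.norm_cpow_real]
    refine (Real.rpow_le_rpow_of_exponent_le (one_le_norm_reOneLine u)
      (by linarith : -s ≤ 1)).trans ?_
    rw [Real.rpow_one]
    exact norm_reOneLine_le u
  have hderiv (u s : ℝ) : HasDerivAt (fun s : ℝ ↦ gaussianWeight u * reOneLine u ^ (-s : ℂ))
      (gaussianWeight u * (reOneLine u ^ (-s : ℂ) * Complex.log (reOneLine u) * (-1))) s := by
    have h1 := ((hasDerivAt_neg (s : ℂ)).const_cpow
      (c := reOneLine u) (Or.inl (reOneLine_ne_zero u))).comp_ofReal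
    exact h1.const_mul _
  have hbound (u s : ℝ) (hs : s ∈ Set.Ioi (-1 : ℝ)) :
      ‖gaussianWeight u * (reOneLine u ^ (-s : ℂ) * Complex.log (reOneLine u) * (-1))‖ ≤
        (1 + π) * (‖gaussianWeight u‖ * (1 + u ^ 2) ^ 2) := by
    rw [norm_mul, norm_mul, norm_mul, norm_neg, norm_one, mul_one,
      mul_left_comm (1 + π)]
    refine mul_le_mul_of_nonneg_left ?_ (norm_nonneg _)
    calc ‖reOneLine u ^ (-s : ℂ)‖ * ‖Complex.log (reOneLine u)‖
        ≤ (1 + u ^ 2) * ((1 + π) * (1 + u ^ 2)) :=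
          mul_le_mul (hnorm hs u) (norm_log_reOneLine_le u) (norm_nonneg _) (by positivity)
      _ = _ := by ring
  have hint : Integrable fun u ↦ gaussianWeight u * reOneLine u ^ (-(0 : ℝ) : ℂ) :=
    integrable_gaussianWeight_mul (hpow 0).aestronglyMeasurable (C := 1) (k := 1)
      fun u ↦ by simpa only [one_mul, pow_one] using hnorm (by norm_num : (-1 : ℝ) < 0) u
  have hmeas : AEStronglyMeasurable (fun u ↦ gaussianWeight u *
      (reOneLine u ^ (-(0 : ℝ) : ℂ) * Complex.log (reOneLine u) * (-1))) volume :=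
    (continuous_gaussianWeight.mul
      (((hpow 0).mul hlog).mul continuous_const)).aestronglyMeasurable
  have h := (hasDerivAt_integral_of_dominated_loc_of_deriv_le
    (𝕜 := ℝ) (x₀ := (0 : ℝ)) (μ := volume)
    (F := fun (s : ℝ) u ↦ gaussianWeight u * reOneLine u ^ (-s : ℂ))
    (F' := fun (s : ℝ) u ↦ gaussianWeight u *
      (reOneLine u ^ (-s : ℂ) * Complex.log (reOneLine u) * (-1)))
    (Ioi_mem_nhds (by norm_num : (-1 : ℝ) < 0))
    (.of_forall fun s ↦ (continuous_gaussianWeight.mul (hpow s)).aestronglyMeasurable)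
    hint hmeas (.of_forall hbound) ((integrable_norm_gaussianWeight_mul_pow 2).const_mul _)
    (.of_forall fun u s _ ↦ hderiv u s)).2
  refine h.congr_deriv ?_
  rw [← integral_neg]
  congr with u
  simp

lemma integral_gaussianWeight_mul_log :
    ∫ u, gaussianWeight u * Complex.log (reOneLine u) = -((√π * eulerMascheroniConstant : ℝ) : ℂ) := by
  have hG : HasDerivAt (fun s : ℝ ↦ 2 * √π * Real.Gamma (s / 2 + 1) / Real.Gamma (s + 1))
      (√π * eulerMascheroniConstant) 0 := by
    have h1 : HasDerivAt (fun s : ℝ ↦ Real.Gamma (s + 1)) (-eulerMascheroniConstant) 0 := by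
      refine (HasDerivAt.comp (h₂ := Real.Gamma) 0 ?_ ((hasDerivAt_id (0 : ℝ)).add_const 1)).congr_deriv
        (mul_one _)
      simpa using Real.hasDerivAt_Gamma_one
    have h2 : HasDerivAt (fun s : ℝ ↦ Real.Gamma (s / 2 + 1))
        (-eulerMascheroniConstant * (1 / 2)) 0 := by
      refine HasDerivAt.comp (h₂ := Real.Gamma) 0 ?_
        (((hasDerivAt_id (0 : ℝ)).div_const 2).add_const 1)
      simpa using Real.hasDerivAt_Gamma_one
    refine ((h2.const_mul (2 * √π)).div h1 (by simp)).congr_deriv ?_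
    simp
    ring
  have heq (s : ℝ) (hs : s ∈ Set.Ici (0 : ℝ)) :
      ∫ u, gaussianWeight u * reOneLine u ^ (-s : ℂ) =
        ((2 * √π * Real.Gamma (s / 2 + 1) / Real.Gamma (s + 1) : ℝ) : ℂ) := by
    rcases (show (0 : ℝ) ≤ s from hs).eq_or_lt with rfl | hs
    · simp [integral_gaussianWeight]
    · have := (Real.Gamma_pos_of_pos hs).ne'
      rw [integral_gaussianWeight_mul_cpow hs, Real.Gamma_add_one hs.ne',
        Real.Gamma_add_one (by positivity)]
      congr 1
      field_simp
  have h := (uniqueDiffWithinAt_Ici (0 : ℝ)).eq_deriv _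
    (hasDerivAt_integral_gaussianWeight_mul_cpow.hasDerivWithinAt)
    (hG.ofReal_comp.hasDerivWithinAt.congr heq (heq 0 Set.self_mem_Ici))
  rw [← h, neg_neg]

lemma exists_norm_sigmaRatioSeries_le {m : ℕ} (hm : 3 ≤ m) :
    ∃ C, 0 ≤ C ∧ ∀ τ : ℂ, 0 < τ.im → ‖sigmaRatioSeries τ‖ ≤ C * τ.im⁻¹ ^ m := by
  have hsum : Summable fun n : ℕ ↦ 1 / (n : ℝ) ^ 2 := Real.summable_one_div_nat_pow.2 one_lt_two
  refine ⟨m.factorial * ∑' n : ℕ, 1 / (n : ℝ) ^ 2, by positivity, fun τ hτ ↦ ?_⟩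
  rw [mul_right_comm]
  refine tsum_of_norm_bounded (hsum.hasSum.mul_left _) fun n ↦
    (norm_sigmaRatio_mul_exp_le n τ).trans ?_
  rcases n.eq_zero_or_pos with rfl | hn
  · simp
  have hn1 : (1 : ℝ) ≤ n := mod_cast hn
  have hx : 0 < τ.im * n := by positivity
  have h1 := Real.pow_div_factorial_le_exp _ hx.le m
  have h2 : Real.exp (-(2 * π * τ.im) * n) ≤ m.factorial / (τ.im * n) ^ m := by
    rw [← inv_div, neg_mul, Real.exp_neg]
    refine inv_anti₀ (by positivity) (h1.trans (Real.exp_le_exp.2 ?_))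
    nlinarith [pi_gt_three]
  calc (n : ℝ) * Real.exp (-(2 * π * τ.im) * n)
      ≤ n * (m.factorial / (τ.im * n) ^ m) := by gcongr
    _ = m.factorial * τ.im⁻¹ ^ m * (n / n ^ m) := by rw [mul_pow, inv_pow]; field_simp
    _ ≤ m.factorial * τ.im⁻¹ ^ m * (n / n ^ 3) := by gcongr
    _ = m.factorial * τ.im⁻¹ ^ m * (1 / n ^ 2) := by field_simp

lemma continuous_sigmaRatioSeries_comp {f : ℝ → ℂ} (hf : Continuous f) (him : ∀ u, 0 < (f u).im) :
    Continuous fun u ↦ sigmaRatioSeries (f u) :=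
  continuous_iff_continuousAt.2 fun u ↦
    (hasDerivAt_sigmaRatioSeries ⟨f u, him u⟩).continuousAt.comp (f := f) hf.continuousAt

lemma im_mul_I_mul_reOneLine (c u : ℝ) : (c * Complex.I * reOneLine u).im = c := by
  simp [reOneLine]

lemma inv_im_neg_inv_mul_I_mul_reOneLine (c u : ℝ) :
    ((-(c * Complex.I * reOneLine u))⁻¹).im⁻¹ = c * (1 + u ^ 2) := by
  rw [Complex.inv_im, Complex.neg_im, im_mul_I_mul_reOneLine, neg_neg, inv_div, Complex.normSq_neg,
    map_mul, map_mul, Complex.normSq_I, Complex.normSq_ofReal, Complex.normSq_eq_norm_sq,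
    sq_norm_reOneLine, mul_one, mul_right_comm, mul_div_assoc, mul_assoc]
  rcases eq_or_ne c 0 with rfl | hc
  · simp
  · field_simp

lemma im_neg_inv_mul_I_mul_reOneLine_pos {c : ℝ} (hc : 0 < c) (u : ℝ) :
    0 < ((-(c * Complex.I * reOneLine u))⁻¹).im := by
  rw [← inv_pos, inv_im_neg_inv_mul_I_mul_reOneLine]
  positivity

lemma hasSum_integral_gaussianWeight_mul_sigmaRatioSeries {c : ℝ} (hc : 0 < c) :
    HasSum (fun n : ℕ ↦ ((2 * √π * (sigmaRatio n * Real.exp (-(2 * π * c * n) ^ 2)) : ℝ) : ℂ))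
      (∫ u, gaussianWeight u * sigmaRatioSeries (c * Complex.I * reOneLine u)) := by
  have hG : Integrable fun u ↦ ‖gaussianWeight u‖ := by
    simpa using integrable_norm_gaussianWeight_mul_pow 0
  let F : ℕ → ℝ → ℂ := fun n u ↦ gaussianWeight u * ((sigmaRatio n : ℂ) *
    Complex.exp (2 * π * Complex.I * n * (c * Complex.I * reOneLine u)))
  have hbound (n : ℕ) (u : ℝ) :
      ‖(sigmaRatio n : ℂ) * Complex.exp (2 * π * Complex.I * n * (c * Complex.I * reOneLine u))‖ ≤
        n * Real.exp (-(2 * π * c) * n) := by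
    simpa only [im_mul_I_mul_reOneLine] using
      norm_sigmaRatio_mul_exp_le n (c * Complex.I * reOneLine u)
  have hint (n : ℕ) : Integrable (F n) :=
    integrable_gaussianWeight_mul (by fun_prop) (k := 0) fun u ↦ by simpa using hbound n u
  have h := hasSum_integral_of_summable_integral_norm hint <| by
    refine .of_nonneg_of_le (fun n ↦ by positivity) (fun n ↦ ?_)
      (by simpa using (summable_nat_pow_mul_exp 1 hc).mul_left (∫ u, ‖gaussianWeight u‖))
    rw [← integral_mul_const]
    refine integral_mono (hint n).norm (hG.mul_const _) fun u ↦ ?_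
    simp only [F]
    rw [norm_mul, ← neg_mul]
    exact mul_le_mul_of_nonneg_left (hbound n u) (norm_nonneg _)
  convert! h using 2 with n
  · have hexp (u : ℝ) : 2 * π * Complex.I * n * (c * Complex.I * reOneLine u) =
        -(reOneLine u * (2 * π * c * n : ℝ)) := by
      push_cast
      linear_combination (2 * π * n * c * reOneLine u) * Complex.I_sq
    simp only [F, hexp, mul_left_comm (gaussianWeight _)]
    rw [integral_const_mul, integral_gaussianWeight_mul_exp]
    push_cast
    ring
  · ext u
    simp only [F]
    rw [tsum_mul_left, sigmaRatioSeries]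

lemma integral_gaussianWeight_mul_sigmaRatioSeries {c : ℝ} (hc : 0 < c) :
    ∫ u, gaussianWeight u * sigmaRatioSeries (c * Complex.I * reOneLine u) =
      ((π ^ 2 / (12 * c) + √π * Real.log c - √π * eulerMascheroniConstant / 2 : ℝ) : ℂ) +
      ∫ u, gaussianWeight u * sigmaRatioSeries (-(c * Complex.I * reOneLine u))⁻¹ := by
  have hc' : (c : ℂ) ≠ 0 := mod_cast hc.ne'
  have hexp (u : ℝ) : gaussianWeight u * sigmaRatioSeries (c * Complex.I * reOneLine u) =
      (-(π * c / 12)) * (gaussianWeight u * reOneLine u) +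
      (π / (12 * c)) * (gaussianWeight u * (reOneLine u)⁻¹) +
      (Real.log c / 2) * gaussianWeight u +
      (1 / 2) * (gaussianWeight u * Complex.log (reOneLine u)) +
      gaussianWeight u * sigmaRatioSeries (-(c * Complex.I * reOneLine u))⁻¹ := by
    have hv := reOneLine_ne_zero u
    have h1 : -Complex.I * (c * Complex.I * reOneLine u) = c * reOneLine u := by
      linear_combination (-c * reOneLine u) * Complex.I_sq
    have h2 : (c * Complex.I * reOneLine u)⁻¹ = -Complex.I * ((c : ℂ)⁻¹ * (reOneLine u)⁻¹) := by
      rw [mul_inv, mul_inv, Complex.inv_I]; ring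
    rw [sigmaRatioSeries_eq (by rwa [im_mul_I_mul_reOneLine]), h1, h2, Complex.log_ofReal_mul hc hv]
    have h3 : (π / (12 * c) : ℂ) = π / 12 * (c : ℂ)⁻¹ := by field_simp
    rw [h3]
    linear_combination gaussianWeight u * (π / 12) *
      (c * reOneLine u - (c : ℂ)⁻¹ * (reOneLine u)⁻¹) * Complex.I_sq
  have hslit (u : ℝ) : reOneLine u ∈ Complex.slitPlane := Or.inl (by simp [reOneLine_re])
  have i1 : Integrable fun u ↦ gaussianWeight u * reOneLine u :=
    integrable_gaussianWeight_mul (by fun_prop) (C := 1) (k := 1)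
      fun u ↦ by simpa using norm_reOneLine_le u
  have i2 : Integrable fun u ↦ gaussianWeight u * (reOneLine u)⁻¹ :=
    integrable_gaussianWeight_mul
      (continuous_reOneLine.inv₀ reOneLine_ne_zero).aestronglyMeasurable (C := 1) (k := 0)
      fun u ↦ by simpa using inv_le_one_of_one_le₀ (one_le_norm_reOneLine u)
  have i3 : Integrable gaussianWeight := by
    simpa using integrable_gaussianWeight_mul (f := fun _ ↦ 1) (by fun_prop) (C := 1) (k := 0)
      fun u ↦ by simp
  have i4 : Integrable fun u ↦ gaussianWeight u * Complex.log (reOneLine u) :=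
    integrable_gaussianWeight_mul (continuous_reOneLine.clog hslit).aestronglyMeasurable (k := 1)
      fun u ↦ by simpa using norm_log_reOneLine_le u
  have i5 : Integrable fun u ↦
      gaussianWeight u * sigmaRatioSeries (-(c * Complex.I * reOneLine u))⁻¹ := by
    obtain ⟨C, hC, hb⟩ := exists_norm_sigmaRatioSeries_le le_rfl
    refine integrable_gaussianWeight_mul (continuous_sigmaRatioSeries_comp (Continuous.inv₀
      (by fun_prop) fun u ↦ ?_) (im_neg_inv_mul_I_mul_reOneLine_pos hc)).aestronglyMeasurable
      (C := C * c ^ 3) (k := 3) fun u ↦ ?_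
    · simp [hc', reOneLine_ne_zero]
    · refine (hb _ (im_neg_inv_mul_I_mul_reOneLine_pos hc u)).trans_eq ?_
      rw [inv_im_neg_inv_mul_I_mul_reOneLine]
      ring
  simp_rw [hexp]
  have j1 := (i1.const_mul (-(π * c / 12) : ℂ))
  have j2 := (i2.const_mul (π / (12 * c) : ℂ))
  have j3 := (i3.const_mul (Real.log c / 2 : ℂ))
  have j4 := (i4.const_mul (1 / 2 : ℂ))
  rw [integral_add (((j1.fun_add j2).fun_add j3).fun_add j4) i5,
    integral_add ((j1.fun_add j2).fun_add j3) j4,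
    integral_add (j1.fun_add j2) j3, integral_add j1 j2]
  simp only [integral_const_mul, integral_gaussianWeight_mul_reOneLine, integral_gaussianWeight,
    integral_gaussianWeight_div_reOneLine, integral_gaussianWeight_mul_log]
  push_cast
  field_simp
  ring

lemma exists_norm_integral_gaussianWeight_mul_sigmaRatioSeries_le {m : ℕ} (hm : 3 ≤ m) :
    ∃ C, ∀ c : ℝ, 0 < c →
      ‖∫ u, gaussianWeight u * sigmaRatioSeries (-(c * Complex.I * reOneLine u))⁻¹‖ ≤
        C * c ^ m := by
  obtain ⟨C, hC, hb⟩ := exists_norm_sigmaRatioSeries_le hm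
  refine ⟨C * ∫ u, ‖gaussianWeight u‖ * (1 + u ^ 2) ^ m, fun c hc ↦ ?_⟩
  rw [mul_right_comm, ← integral_const_mul]
  refine norm_integral_le_of_norm_le ((integrable_norm_gaussianWeight_mul_pow m).const_mul _)
    (.of_forall fun u ↦ ?_)
  rw [norm_mul]
  refine (mul_le_mul_of_nonneg_left (hb _ (im_neg_inv_mul_I_mul_reOneLine_pos hc u))
    (norm_nonneg _)).trans_eq ?_
  rw [inv_im_neg_inv_mul_I_mul_reOneLine, mul_pow]
  ring

end

lemma tsum_sigma_one_div_eq {x : ℝ} (hx : 0 < x) :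
    ((2 * √π * ((∑' n : ℕ, ((∑ d ∈ (n + 1 : ℕ).divisors, d : ℕ) : ℝ) / ((n + 1 : ℕ) : ℝ) *
        Real.exp (-(((n + 1 : ℕ) : ℝ) ^ 2 * x))) -
      (π ^ ((5 : ℝ) / 2) / (12 * Real.sqrt x) + Real.log x / 4 -
        Real.log (Real.sqrt (2 * π)) - Real.eulerMascheroniConstant / 4)) : ℝ) : ℂ) =
    ∫ u, gaussianWeight u *
      sigmaRatioSeries (-((√x / (2 * π) : ℝ) * Complex.I * reOneLine u))⁻¹ := by
  have hsx : 0 < √x := Real.sqrt_pos.2 hx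
  have hsp : 0 < √π := Real.sqrt_pos.2 pi_pos
  have hc : 0 < √x / (2 * π) := by positivity
  have h1 := hasSum_integral_gaussianWeight_mul_sigmaRatioSeries hc
  rw [integral_gaussianWeight_mul_sigmaRatioSeries hc] at h1
  have hterm (n : ℕ) : 2 * √π * (sigmaRatio n *
      Real.exp (-(2 * π * (√x / (2 * π)) * n) ^ 2)) =
      2 * √π * (sigmaRatio n * Real.exp (-((n : ℝ) ^ 2 * x))) := by
    have : 2 * π * (√x / (2 * π)) * n = √x * n := by field_simp
    rw [this, mul_pow, Real.sq_sqrt hx.le, mul_comm x]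
  simp only [hterm] at h1
  rw [← sub_eq_iff_eq_add'.2 h1.tsum_eq, ← Complex.ofReal_tsum, ← Complex.ofReal_sub,
    Complex.ofReal_inj, tsum_mul_left]
  have h2 : Summable fun n : ℕ ↦ sigmaRatio n * Real.exp (-((n : ℝ) ^ 2 * x)) :=
    (summable_mul_left_iff (by positivity : 2 * √π ≠ 0)).1
      (Complex.hasSum_iff _ _ |>.1 h1).1.summable
  rw [h2.tsum_eq_zero_add, mul_sub]
  have h3 : π ^ ((5 : ℝ) / 2) = π ^ 2 * √π := by
    rw [Real.sqrt_eq_rpow, ← Real.rpow_two, ← Real.rpow_add pi_pos]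
    norm_num
  have h4 : Real.log (√x / (2 * π)) = Real.log x / 2 - 2 * Real.log √(2 * π) := by
    rw [Real.log_div hsx.ne' (by positivity), Real.log_sqrt hx.le, Real.log_sqrt (by positivity)]
    ring
  rw [h3, h4]
  have h5 : √π * √π = π := Real.mul_self_sqrt pi_pos.le
  congr 1
  · simp [sigmaRatio, ArithmeticFunction.sigma_one_apply]
  · have : π ^ 2 / (12 * (√x / (2 * π))) = 2 * √π * (π ^ 2 * √π / (12 * √x)) := by
      rw [show 2 * √π * (π ^ 2 * √π / (12 * √x)) = (√π * √π) * (2 * π ^ 2 / (12 * √x)) by ring, h5]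
      field_simp
    rw [this]
    ring

/-- asymptotics of `∑_{n≥1} σ(n) e^{-n² x}/n` as `x → 0⁺`. -/
theorem sum_sigma_one_div_n_asymp (N : ℕ) :
    (fun x : ℝ =>
      (∑' n : ℕ, ((∑ d ∈ (n + 1 : ℕ).divisors, d : ℕ) : ℝ) / ((n + 1 : ℕ) : ℝ) *
        Real.exp (-(((n + 1 : ℕ) : ℝ) ^ 2 * x))) -
      (π ^ ((5 : ℝ) / 2) / (12 * Real.sqrt x) + Real.log x / 4 -
        Real.log (Real.sqrt (2 * π)) - Real.eulerMascheroniConstant / 4))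
      =o[nhdsWithin 0 (Set.Ioi 0)]
    fun x : ℝ => x ^ N := by
  obtain ⟨C, hC⟩ := exists_norm_integral_gaussianWeight_mul_sigmaRatioSeries_le
    (m := 2 * N + 4) (by omega)
  have hlittle : (fun x : ℝ ↦ x ^ (N + 2)) =o[nhdsWithin 0 (Set.Ioi 0)] fun x : ℝ ↦ x ^ N :=
    (isLittleO_pow_pow (by omega)).mono nhdsWithin_le_nhds
  refine IsBigO.trans_isLittleO (.of_bound (C / (2 * √π) / (2 * π) ^ (2 * N + 4)) ?_) hlittle
  filter_upwards [self_mem_nhdsWithin] with x (hx : 0 < x)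
  have h := hC (√x / (2 * π)) (by positivity)
  rw [← tsum_sigma_one_div_eq hx, Complex.norm_real, norm_mul,
    Real.norm_of_nonneg (by positivity : 0 ≤ 2 * √π), div_pow,
    show 2 * N + 4 = 2 * (N + 2) by ring, pow_mul (√x), Real.sq_sqrt hx.le] at h
  rw [Real.norm_of_nonneg (by positivity : 0 ≤ x ^ (N + 2)),
    show 2 * N + 4 = 2 * (N + 2) by ring, div_div, div_mul_eq_mul_div, le_div_iff₀ (by positivity)]
  rw [mul_div_assoc', le_div_iff₀ (by positivity)] at h
  linarith
end
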